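/- arXiv:2307.07223 — 3 statements merged into one kernel-verified Lean document; each statement's English description precedes it below -/
import Mathlib

section
/- The following are equivalent: (1) there exists a countably infinite subset of ℝ^{ω₁} that is closed, discrete in the subspace topology, and not C*-embedded in ℝ^{ω₁}; (2) there exists a nonempty compact Hausdorff space X together with a family of ℵ₁ many closed Gδ subsets of X whose union is X such that no countable subfamily has union X. -/
open Set Ordinal

/-- An index type of cardinality `ℵ₁`: the countable ordinals. -/
abbrev Omega1Index : Type 1 := {o : Ordinal // o < Ordinal.omega 1}

open Filter Topology

theorem pa_step {M Y : Type*} [MetricSpace M] [TopologicalSpace Y] [Nonempty Y]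
    [TopologicalSpace.SeparableSpace Y] (π : Y → M) (φ : ℕ → M)
    (H1 : ∀ ε > 0, ∀ᶠ n in atTop, ∃ y, dist (φ n) (π y) < ε)
    (H2 : ∀ y, ∀ ε > 0, ∃ᶠ n in atTop, dist (φ n) (π y) < ε) :
    ∃ ξ : ℕ → Y, Tendsto (fun n => dist (φ n) (π (ξ n))) atTop (𝓝 0) ∧
      ∀ y, MapClusterPt y atTop ξ := by
  classical
  let d0 := TopologicalSpace.denseSeq Y
  have hne : (range π).Nonempty := range_nonempty π
  have hd : ∀ n : ℕ, ∃ y, dist (φ n) (π y) < Metric.infDist (φ n) (range π) + 1 / ((n : ℝ) + 1) := by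
    intro n
    have : Metric.infDist (φ n) (range π) < Metric.infDist (φ n) (range π) + 1 / ((n : ℝ) + 1) := by
      have : (0 : ℝ) < 1 / ((n : ℝ) + 1) := by positivity
      linarith
    obtain ⟨_, ⟨y, rfl⟩, hy⟩ := (Metric.infDist_lt_iff hne).1 this
    exact ⟨y, hy⟩
  choose d hd using hd
  have hd1 : ∀ ε > 0, ∀ᶠ n in atTop, dist (φ n) (π (d n)) < ε := by
    intro ε hε
    have h1 := H1 (ε / 2) (by positivity)
    have h2 : ∀ᶠ n : ℕ in atTop, 1 / ((n : ℝ) + 1) < ε / 2 :=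
      (tendsto_order.1 (tendsto_one_div_add_atTop_nhds_zero_nat (𝕜 := ℝ))).2 _ (by positivity)
    filter_upwards [h1, h2] with n ⟨y, hy⟩ h2
    have := Metric.infDist_le_dist_of_mem (x := φ n) (mem_range_self (f := π) y)
    linarith [hd n]
  obtain ⟨m, hm, hm2⟩ := extraction_forall_of_frequently
    (P := fun j n => dist (φ n) (π (d0 j.unpair.1)) < 1 / ((j : ℝ) + 1))
    (fun j => H2 _ _ (by positivity))
  refine ⟨Function.extend m (fun j => d0 j.unpair.1) d, ?_, ?_⟩
  · rw [Metric.tendsto_nhds]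
    intro ε hε
    have h2 : ∀ᶠ n : ℕ in atTop, 1 / ((n : ℝ) + 1) < ε :=
      (tendsto_order.1 (tendsto_one_div_add_atTop_nhds_zero_nat (𝕜 := ℝ))).2 _ hε
    obtain ⟨J, hJ⟩ := eventually_atTop.1 h2
    filter_upwards [hd1 ε hε, eventually_ge_atTop (m J)] with n h1 hn
    rw [Real.dist_0_eq_abs, abs_of_nonneg dist_nonneg]
    by_cases h : ∃ j, m j = n
    · obtain ⟨j, rfl⟩ := h
      rw [hm.injective.extend_apply]
      exact (hm2 j).trans (hJ j (hm.le_iff_le.1 hn))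
    · rw [Function.extend_apply' _ _ _ h]
      exact h1
  · intro y
    rw [mapClusterPt_iff_frequently]
    intro U hU
    obtain ⟨_, ⟨k, rfl⟩, hk⟩ := (TopologicalSpace.denseRange_denseSeq Y).inter_nhds_nonempty hU
    rw [frequently_atTop]
    intro a
    refine ⟨m (Nat.pair k a), ?_, ?_⟩
    · exact (Nat.right_le_pair k a).trans (hm.id_le _)
    · rw [hm.injective.extend_apply]
      simpa using hk

abbrev PaI := unitInterval

def PaGood {ι : Type*} (K : Set (ι → PaI)) (h : ι → ℕ → PaI) (S : Set ι) : Prop :=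
  (∀ p : Ultrafilter ℕ, (p : Filter ℕ) ≤ atTop → ∃ y ∈ K, ∀ β ∈ S, Tendsto (h β) p (𝓝 (y β))) ∧
  (∀ y ∈ K, ∃ p : Ultrafilter ℕ, (p : Filter ℕ) ≤ atTop ∧ ∀ β ∈ S, Tendsto (h β) p (𝓝 (y β)))

theorem PaGood.congr {ι : Type*} {K : Set (ι → PaI)} {h h' : ι → ℕ → PaI} {S : Set ι}
    (H : PaGood K h S) (e : ∀ β ∈ S, h β = h' β) : PaGood K h' S := by
  refine ⟨fun p hp => ?_, fun y hy => ?_⟩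
  · obtain ⟨y, hy, h2⟩ := H.1 p hp
    exact ⟨y, hy, fun β hβ => e β hβ ▸ h2 β hβ⟩
  · obtain ⟨p, hp, h2⟩ := H.2 y hy
    exact ⟨p, hp, fun β hβ => e β hβ ▸ h2 β hβ⟩

theorem PaGood.step {ι : Type*} [DecidableEq ι] {K : Set (ι → PaI)} {h : ι → ℕ → PaI} {S : Set ι}
    (hK : IsCompact K) (hne : K.Nonempty) (hS : S.Countable) {α : ι} (hα : α ∉ S)
    (H : PaGood K h S) : ∃ ψ, PaGood K (Function.update h α ψ) (insert α S) := by
  set T : Set ι := insert α S with hT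
  have hTc : T.Countable := hS.insert α
  have : Countable S := hS.to_subtype
  have : Countable T := hTc.to_subtype
  have hcr : Continuous (T.domRestrict : (ι → PaI) → (T → PaI)) := by
    exact continuous_pi fun i => continuous_apply _
  have : CompactSpace (T.domRestrict '' K) := isCompact_iff_compactSpace.1 (hK.image hcr)
  have : Nonempty (T.domRestrict '' K) := (hne.image _).to_subtype
  let : MetricSpace (S → PaI) := TopologicalSpace.metrizableSpaceMetric _
  let π : (T.domRestrict '' K) → (S → PaI) := fun y s => y.1 ⟨s.1, mem_insert_of_mem _ s.2⟩
  have hπ : Continuous π :=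
    continuous_pi fun s => (continuous_apply _).comp continuous_subtype_val
  let φ : ℕ → (S → PaI) := fun n s => h s n
  obtain ⟨ξ, hξ1, hξ2⟩ := pa_step π φ (by
    intro ε hε
    by_contra hcon
    rw [not_eventually] at hcon
    rw [frequently_iff_neBot] at hcon
    let p := Ultrafilter.of (atTop ⊓ 𝓟 {x | ¬∃ y, dist (φ x) (π y) < ε})
    have hp : (p : Filter ℕ) ≤ _ := Ultrafilter.of_le (atTop ⊓ 𝓟 {x | ¬∃ y, dist (φ x) (π y) < ε})
    obtain ⟨y, hy, hy2⟩ := H.1 p (hp.trans inf_le_left)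
    have h1 : Tendsto φ p (𝓝 (π ⟨T.domRestrict y, mem_image_of_mem _ hy⟩)) :=
      tendsto_pi_nhds.2 fun s => hy2 s s.2
    have h2 : ∀ᶠ n in (p : Filter ℕ), ¬∃ y, dist (φ n) (π y) < ε :=
      (hp.trans inf_le_right) (mem_principal_self _)
    obtain ⟨n, h3, h4⟩ := ((Metric.tendsto_nhds.1 h1 ε hε).and h2).exists
    exact h4 ⟨_, h3⟩) (by
    rintro ⟨_, y, hy, rfl⟩ ε hε
    obtain ⟨p, hp, hy2⟩ := H.2 y hy
    have h1 : Tendsto φ p (𝓝 (π ⟨T.domRestrict y, mem_image_of_mem _ hy⟩)) :=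
      tendsto_pi_nhds.2 fun s => hy2 s s.2
    exact (Metric.tendsto_nhds.1 h1 ε hε).frequently.filter_mono hp)
  have key : ∀ (p : Ultrafilter ℕ), (p : Filter ℕ) ≤ atTop → ∀ y : T.domRestrict '' K,
      Tendsto ξ p (𝓝 y) → ∀ x : ι → PaI, T.domRestrict x = y.1 → ∀ β ∈ T,
      Tendsto (Function.update h α (fun n => (ξ n).1 ⟨α, mem_insert _ _⟩) β) p (𝓝 (x β)) := by
    intro p hp y hy x hx β hβ
    have hxv : ∀ b : T, x b = y.1 b := fun b => congrFun hx b
    rcases hβ with rfl | hβ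
    · rw [Function.update_self, hxv ⟨β, mem_insert _ _⟩]
      exact ((continuous_apply _).comp continuous_subtype_val).continuousAt.tendsto.comp hy
    · have hb : β ≠ α := fun e => hα (e ▸ hβ)
      rw [Function.update_of_ne hb, hxv ⟨β, mem_insert_of_mem _ hβ⟩]
      have h1 : Tendsto φ p (𝓝 (π y)) :=
        (tendsto_iff_of_dist (hξ1.mono_left hp)).2 ((hπ.tendsto y).comp hy)
      exact (tendsto_pi_nhds.1 h1) ⟨β, hβ⟩
  refine ⟨fun n => (ξ n).1 ⟨α, mem_insert _ _⟩, ?_, ?_⟩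
  · intro p hp
    have := (p.map ξ).le_nhds_lim
    obtain ⟨x, hx, hx2⟩ := (p.map ξ).lim.2
    exact ⟨x, hx, key p hp _ this x hx2⟩
  · intro y hy
    obtain ⟨p, hp, hp2⟩ := mapClusterPt_iff_ultrafilter.1 (hξ2 ⟨T.domRestrict y, mem_image_of_mem _ hy⟩)
    exact ⟨p, hp, key p hp _ hp2 y rfl⟩

theorem pa_isClosed_tendsto {A B : Type*} [TopologicalSpace B] (f : A → B) (b : B) :
    IsClosed {p : Ultrafilter A | Tendsto f p (𝓝 b)} := by
  have : {p : Ultrafilter A | Tendsto f p (𝓝 b)} = ⋂ U ∈ 𝓝 b, {p : Ultrafilter A | f ⁻¹' U ∈ p} := by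
    ext p; simp [Tendsto, Filter.le_def]
  rw [this]
  exact isClosed_biInter fun U _ => ultrafilter_isClosed_basic _

theorem pa_isClosed_le {A : Type*} (F : Filter A) :
    IsClosed {p : Ultrafilter A | (p : Filter A) ≤ F} := by
  have : {p : Ultrafilter A | (p : Filter A) ≤ F} = ⋂ U ∈ F, {p : Ultrafilter A | U ∈ p} := by
    ext p; simp [Filter.le_def]
  rw [this]
  exact isClosed_biInter fun U _ => ultrafilter_isClosed_basic _

theorem PaGood.union {ι : Type*} [LinearOrder ι] {K : Set (ι → PaI)} {h : ι → ℕ → PaI}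
    (hK : IsCompact K) (hne : K.Nonempty) {A : Set ι} (H : ∀ β ∈ A, PaGood K h (Iic β)) :
    PaGood K h A := by
  constructor
  · intro p hp
    have hl : ∀ β, Tendsto (h β) p (𝓝 (p.map (h β)).lim) := fun β => (p.map (h β)).le_nhds_lim
    obtain ⟨y, hy, hy2⟩ := hK.inter_iInter_nonempty
      (fun β : A => {x : ι → PaI | x β = (p.map (h β)).lim})
      (fun β => isClosed_eq (continuous_apply _) continuous_const) (by
        intro u
        rcases u.eq_empty_or_nonempty with rfl | ⟨b, hb⟩
        · simpa using hne
        · have : Nonempty A := ⟨b⟩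
          obtain ⟨m, hm⟩ := u.exists_le
          obtain ⟨x, hx, hx2⟩ := (H m m.2).1 p hp
          refine ⟨x, hx, ?_⟩
          simp only [mem_iInter]
          intro i hi
          exact tendsto_nhds_unique (hx2 i (hm i hi)) (hl i))
    refine ⟨y, hy, fun β hβ => ?_⟩
    have := mem_iInter.1 hy2 ⟨β, hβ⟩
    simp only [mem_ofPred_eq] at this
    rw [this]
    exact hl β
  · intro y hy
    obtain ⟨p, hp, hp2⟩ := (pa_isClosed_le (atTop : Filter ℕ)).isCompact.inter_iInter_nonempty
      (fun β : A => {p : Ultrafilter ℕ | Tendsto (h β) p (𝓝 (y β))})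
      (fun β => pa_isClosed_tendsto _ _) (by
        intro u
        rcases u.eq_empty_or_nonempty with rfl | ⟨b, hb⟩
        · simpa using ⟨Ultrafilter.of (atTop : Filter ℕ), Ultrafilter.of_le _⟩
        · have : Nonempty A := ⟨b⟩
          obtain ⟨m, hm⟩ := u.exists_le
          obtain ⟨x, hx, hx2⟩ := (H m m.2).2 y hy
          refine ⟨x, hx, ?_⟩
          simp only [mem_iInter]
          intro i hi
          exact hx2 i (hm i hi))
    exact ⟨p, hp, fun β hβ => mem_iInter.1 hp2 ⟨β, hβ⟩⟩

theorem pa_exists_good {ι : Type*} [LinearOrder ι] [WellFoundedLT ι]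
    (hc : ∀ α : ι, (Iio α).Countable) {K : Set (ι → PaI)}
    (hK : IsCompact K) (hne : K.Nonempty) : ∃ h, PaGood K h univ := by
  classical
  let F : ∀ α : ι, (∀ β, β < α → ℕ → PaI) → ℕ → PaI := fun α prev =>
    Classical.epsilon fun ψ =>
      PaGood K (fun β => if hb : β < α then prev β hb else ψ) (Iic α)
  let h : ι → ℕ → PaI := WellFounded.fix (wellFounded_lt (α := ι)) F
  have hh : ∀ α, h α = Classical.epsilon fun ψ =>
      PaGood K (fun β => if β < α then h β else ψ) (Iic α) := by
    intro α
    change WellFounded.fix (wellFounded_lt (α := ι)) F α = _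
    rw [WellFounded.fix_eq]
    simp only [F]
    rfl
  refine ⟨h, PaGood.union hK hne fun β _ => ?_⟩
  induction β using WellFoundedLT.induction with
  | ind α ih =>
    have h1 : PaGood K h (Iio α) := PaGood.union hK hne fun β hβ => ih β hβ trivial
    obtain ⟨ψ, hψ⟩ := h1.step hK hne (hc α) (α := α) (by simp)
    have h2 : ∃ ψ, PaGood K (fun β => if β < α then h β else ψ) (Iic α) := by
      refine ⟨ψ, ?_⟩
      rw [Iio_insert] at hψ
      refine hψ.congr fun β hβ => ?_
      rcases eq_or_lt_of_le hβ with rfl | hlt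
      · simp
      · simp [hlt, hlt.ne]
    have h3 := Classical.epsilon_spec h2
    rw [← hh α] at h3
    refine h3.congr fun β hβ => ?_
    rcases eq_or_lt_of_le hβ with rfl | hlt
    · simp
    · simp [hlt]

theorem pa_countable_Iio (α : Omega1Index) : (Iio α).Countable := by
  have h : (Iio α.1).Countable := by
    rw [← Cardinal.le_aleph0_iff_set_countable, Cardinal.mk_Iio_ordinal,
      ← Cardinal.lift_aleph0.{1, 0}, Cardinal.lift_le, ← Order.lt_succ_iff,
      ← Cardinal.aleph_zero, Cardinal.succ_aleph, ← Cardinal.lt_ord, Cardinal.ord_aleph]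
    simpa using α.2
  exact (h.preimage Subtype.val_injective).mono fun x hx => hx

theorem pa_infinite : Infinite Omega1Index := by
  refine Infinite.of_injective
    (fun n : ℕ => (⟨(n : Ordinal), (Ordinal.natCast_lt_omega0 n).trans ?_⟩ : Omega1Index)) ?_
  · rw [← Ordinal.omega_zero]; exact Ordinal.omega_lt_omega.2 zero_lt_one
  · intro a b h
    simpa using h

theorem pa_option_equiv : Nonempty (Option Omega1Index ≃ Omega1Index) := by
  have := pa_infinite
  rw [← Cardinal.eq, Cardinal.mk_option]
  exact Cardinal.add_one_eq (Cardinal.aleph0_le_mk _)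

theorem pa_dir1 (N : Set (Omega1Index → ℝ)) (hN : N.Countable) (hinf : N.Infinite)
    (hcl : IsClosed N) (hd : DiscreteTopology N) (f : C(N, ℝ))
    (hf : ¬ ∃ g : C((Omega1Index → ℝ), ℝ), ∀ x : N, g x.val = f x) :
    (∃ (X : Type) (_ : TopologicalSpace X), CompactSpace X ∧ T2Space X ∧ Nonempty X ∧
      ∃ Z : Omega1Index → Set X,
        (∀ α, IsClosed (Z α)) ∧ (∀ α, IsGδ (Z α)) ∧ (⋃ α, Z α) = Set.univ ∧
        ¬ ∃ C : Set Omega1Index, C.Countable ∧ (⋃ α ∈ C, Z α) = Set.univ) := by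
  have := hN.to_subtype
  have := hinf.to_subtype
  obtain ⟨e⟩ : Nonempty (ℕ ≃ N) := nonempty_equiv_of_countable
  let P : ℕ → (Omega1Index → ℝ) := fun n => (e n).1
  have hP : IsClosedEmbedding P :=
    hcl.isClosedEmbedding_subtypeVal.comp (e.toHomeomorphOfDiscrete).isClosedEmbedding
  have hprop := isProperMap_iff_ultrafilter.1 hP.isProperMap
  refine ⟨{p : Ultrafilter ℕ // (p : Filter ℕ) ≤ cofinite}, inferInstance,
    isCompact_iff_compactSpace.1 (pa_isClosed_le _).isCompact, inferInstance,
    ⟨⟨Ultrafilter.of cofinite, Ultrafilter.of_le _⟩⟩,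
    fun α => {p | ∀ n : ℕ, {k | (n : ℝ) < |P k α|} ∈ p.1}, ?_, ?_, ?_, ?_⟩
  · intro α
    beta_reduce
    rw [ofPred_forall]
    exact isClosed_iInter fun n => (ultrafilter_isClosed_basic _).preimage continuous_subtype_val
  · intro α
    beta_reduce
    rw [ofPred_forall]
    exact .iInter_of_isOpen fun n => (ultrafilter_isOpen_basic _).preimage continuous_subtype_val
  · rw [eq_univ_iff_forall]
    rintro ⟨p, hp⟩
    by_contra hcon
    simp only [mem_iUnion, mem_ofPred_eq, not_exists, not_forall] at hcon
    choose n hn using hcon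
    have hz : ∀ α, ∃ z : ℝ, Tendsto (fun k => P k α) p (𝓝 z) := by
      intro α
      have h1 : {k | (n α : ℝ) < |P k α|}ᶜ ∈ p := Ultrafilter.compl_mem_iff_notMem.2 (hn α)
      obtain ⟨z, _, hz⟩ := (isCompact_Icc (a := -(n α : ℝ)) (b := n α)).ultrafilter_le_nhds'
        (p.map fun k => P k α) (by
          rw [Ultrafilter.mem_map]
          refine mem_of_superset h1 fun k hk => ?_
          have : |P k α| ≤ n α := not_lt.1 hk
          exact abs_le.1 this)
      exact ⟨z, hz⟩
    choose z hz using hz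
    obtain ⟨k, -, hk⟩ := hprop.2 (𝒰 := p) (y := z) (tendsto_pi_nhds.2 hz)
    rw [nhds_discrete] at hk
    have h1 : {k}ᶜ ∈ (p : Filter ℕ) := hp (by simp)
    have h2 : {k} ∈ (p : Filter ℕ) := hk (by simp)
    exact (Ultrafilter.compl_mem_iff_notMem.1 h1) h2
  · rintro ⟨C, hC, hcov⟩
    apply hf
    have hsep : ∀ q : ℕ × ℕ, ∃ α, q.1 ≠ q.2 → P q.1 α ≠ P q.2 α := by
      intro q
      by_cases h : q.1 = q.2
      · have := pa_infinite
        exact ⟨Classical.arbitrary _, fun h' => absurd h h'⟩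
      · obtain ⟨α, hα⟩ := Function.ne_iff.1 (hP.injective.ne h)
        exact ⟨α, fun _ => hα⟩
    choose s hs using hsep
    let D : Set Omega1Index := C ∪ range s
    have hDc : D.Countable := hC.union (countable_range s)
    have : Countable D := hDc.to_subtype
    let Φ : ℕ → (D → ℝ) := fun k α => P k α
    have hinj : Function.Injective Φ := by
      intro a b hab
      by_contra hne
      exact hs (a, b) hne (congrFun hab ⟨s (a, b), Or.inr (mem_range_self _)⟩)
    have hΦ : IsProperMap Φ := by
      rw [isProperMap_iff_ultrafilter]
      refine ⟨continuous_of_discreteTopology, fun p y hy => ?_⟩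
      rcases p.le_cofinite_or_eq_pure with hp | ⟨k, hk⟩
      · exfalso
        have : (⟨p, hp⟩ : {p : Ultrafilter ℕ // (p : Filter ℕ) ≤ cofinite}) ∈ (univ : Set _) := trivial
        rw [← hcov] at this
        simp only [mem_iUnion, mem_ofPred_eq] at this
        obtain ⟨α, hα, hα2⟩ := this
        have h1 : Tendsto (fun k => |P k α|) p (𝓝 |y ⟨α, Or.inl hα⟩|) :=
          (tendsto_pi_nhds.1 hy ⟨α, Or.inl hα⟩).abs
        obtain ⟨n, hn⟩ := exists_nat_gt |y ⟨α, Or.inl hα⟩|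
        have h2 : ∀ᶠ k in (p : Filter ℕ), (n : ℝ) < |P k α| := hα2 n
        obtain ⟨k, h3, h4⟩ := (((tendsto_order.1 h1).2 _ hn).and h2).exists
        exact lt_asymm h3 h4
      · subst hk
        refine ⟨k, ?_, ?_⟩
        · have : Tendsto Φ (pure k) (𝓝 (Φ k)) := tendsto_pure_nhds _ _
          exact tendsto_nhds_unique this hy
        · rw [nhds_discrete]; exact le_rfl
    have hΦ2 : IsClosedEmbedding Φ :=
      .of_continuous_injective_isClosedMap hΦ.continuous hinj hΦ.isClosedMap
    obtain ⟨g, hg⟩ := ContinuousMap.exists_extension' hΦ2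
      (⟨fun k => f (e k), continuous_of_discreteTopology⟩ : C(ℕ, ℝ))
    refine ⟨⟨fun x => g (fun α => x α), ?_⟩, ?_⟩
    · exact g.continuous.comp (continuous_pi fun α => continuous_apply _)
    · intro x
      have := congrFun hg (e.symm x)
      simpa [Φ, P] using this

theorem pa_locdep {ι : Type*} (g : C((ι → ℝ), ℝ)) (x : ι → ℝ) :
    ∃ D : Set ι, D.Countable ∧ ∀ y, (∀ α ∈ D, y α = x α) → g y = g x := by
  have : ∀ k : ℕ, ∃ F : Set ι, F.Finite ∧ ∀ y, (∀ α ∈ F, y α = x α) →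
      dist (g y) (g x) < 1 / ((k : ℝ) + 1) := by
    intro k
    have h := Metric.continuousAt_iff'.1 (g.continuous.continuousAt (x := x))
      (1 / ((k : ℝ) + 1)) (by positivity)
    rw [nhds_pi, Filter.eventually_iff, Filter.mem_pi] at h
    obtain ⟨I, hI, t, ht, hsub⟩ := h
    refine ⟨I, hI, fun y hy => hsub ?_⟩
    intro i hi
    rw [hy i hi]
    exact mem_of_mem_nhds (ht i)
  choose F hF hF2 using this
  refine ⟨⋃ k, F k, countable_iUnion fun k => (hF k).countable, fun y hy => ?_⟩
  by_contra hne
  obtain ⟨k, hk⟩ := exists_nat_one_div_lt (dist_pos.2 hne)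
  exact lt_asymm hk (hF2 k y fun α hα => hy α (mem_iUnion.2 ⟨k, hα⟩))

/-- The coordinates of the closed discrete set. -/
noncomputable def paPt (h : Omega1Index → ℕ → PaI) (q : ℕ × Bool) : Option Omega1Index → ℝ
  | none => 1 / ((2 * q.1 + q.2.toNat : ℕ) + 1 : ℝ)
  | some α => (1 - (h α q.1 : ℝ) + 1 / ((q.1 : ℝ) + 1))⁻¹

theorem pa_dir2 (X : Type) [TopologicalSpace X] [CompactSpace X] [T2Space X] [Nonempty X]
    (Z : Omega1Index → Set X) (hZ : ∀ α, IsClosed (Z α)) (hZ2 : ∀ α, IsGδ (Z α))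
    (hcov : (⋃ α, Z α) = Set.univ)
    (hno : ¬ ∃ C : Set Omega1Index, C.Countable ∧ (⋃ α ∈ C, Z α) = Set.univ) :
    (∃ N : Set (Omega1Index → ℝ),
      N.Countable ∧ N.Infinite ∧ IsClosed N ∧ DiscreteTopology N ∧
      ∃ f : C(N, ℝ), (∃ M : ℝ, ∀ x : N, |f x| ≤ M) ∧
        ¬ ∃ g : C((Omega1Index → ℝ), ℝ), ∀ x : N, g x.val = f x) := by
  classical
  have hu : ∀ α, ∃ u : X → PaI, Continuous u ∧ ∀ x, x ∈ Z α ↔ (u x : ℝ) = 1 := by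
    intro α
    obtain ⟨f, hf, -, -, hf3⟩ := exists_continuous_one_zero_of_isCompact_of_isGδ
      (hZ α).isCompact (hZ2 α) isClosed_empty (disjoint_empty _)
    refine ⟨fun x => ⟨f x, hf3 x⟩, f.continuous.subtype_mk _, fun x => ?_⟩
    rw [hf]; simp
  choose u huc hu using hu
  let U : X → (Omega1Index → PaI) := fun x α => u α x
  have hU : Continuous U := continuous_pi huc
  obtain ⟨h, hh⟩ := pa_exists_good pa_countable_Iio (isCompact_range hU) (range_nonempty U)
  obtain ⟨σ⟩ := pa_option_equiv
  let P : ℕ × Bool → (Omega1Index → ℝ) := fun q β => paPt h q (σ.symm β)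
  have hPn : ∀ q, P q (σ none) = 1 / ((2 * q.1 + q.2.toNat : ℕ) + 1 : ℝ) := by
    intro q; simp [P, paPt]
  have hPs : ∀ q α, P q (σ (some α)) = (1 - (h α q.1 : ℝ) + 1 / ((q.1 : ℝ) + 1))⁻¹ := by
    intro q α; simp [P, paPt]
  have hinj : Function.Injective P := by
    rintro ⟨a, i⟩ ⟨b, j⟩ hab
    have h1 := congrFun hab (σ none)
    rw [hPn, hPn, one_div, one_div, inv_inj, add_left_inj, Nat.cast_inj] at h1
    cases i <;> cases j <;> simp at h1 ⊢ <;> omega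
  have hdecay : Tendsto (fun n : ℕ => 1 / ((n : ℝ) + 1)) atTop (𝓝 0) :=
    tendsto_one_div_add_atTop_nhds_zero_nat
  have hprop : IsProperMap P := by
    rw [isProperMap_iff_ultrafilter]
    refine ⟨continuous_of_discreteTopology, fun p y hy => ?_⟩
    rcases p.le_cofinite_or_eq_pure with hp | ⟨k, hk⟩
    · exfalso
      have hfst : Tendsto (Prod.fst : ℕ × Bool → ℕ) cofinite atTop := by
        rw [← Nat.cofinite_eq_atTop]
        refine Tendsto.cofinite_of_finite_preimage_singleton fun n => ?_
        refine ((finite_singleton n).prod (finite_univ (α := Bool))).subset ?_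
        rintro ⟨a, b⟩ hab
        exact ⟨hab, trivial⟩
      have hq : ((p.map Prod.fst : Ultrafilter ℕ) : Filter ℕ) ≤ atTop := hfst.mono_left hp
      obtain ⟨_, ⟨x, rfl⟩, hx⟩ := hh.1 _ hq
      have : x ∈ ⋃ α, Z α := hcov ▸ mem_univ x
      obtain ⟨α, hα⟩ := mem_iUnion.1 this
      rw [hu] at hα
      have h1 : Tendsto (fun q : ℕ × Bool => (h α q.1 : ℝ)) p (𝓝 1) := by
        rw [← hα]
        exact (continuous_subtype_val.tendsto _).comp (tendsto_map'_iff.1 (hx α trivial))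
      have h2 : Tendsto (fun q : ℕ × Bool => 1 / ((q.1 : ℝ) + 1)) p (𝓝 0) :=
        hdecay.comp (hfst.mono_left hp)
      have h3 : Tendsto (fun q : ℕ × Bool => 1 - (h α q.1 : ℝ) + 1 / ((q.1 : ℝ) + 1)) p (𝓝 0) := by
        simpa using (h1.const_sub 1).add h2
      have h4 := (tendsto_pi_nhds.1 hy (σ (some α))).mul h3
      have h5 : Tendsto (fun _ : ℕ × Bool => (1 : ℝ)) p (𝓝 0) := by
        rw [mul_zero] at h4
        refine h4.congr fun q => ?_
        rw [hPs]
        refine inv_mul_cancel₀ (ne_of_gt ?_)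
        have : (h α q.1 : ℝ) ≤ 1 := (h α q.1).2.2
        have : (0 : ℝ) < 1 / ((q.1 : ℝ) + 1) := by positivity
        linarith
      exact zero_ne_one (tendsto_nhds_unique h5 tendsto_const_nhds)
    · subst hk
      refine ⟨k, ?_, ?_⟩
      · have : Tendsto P (pure k) (𝓝 (P k)) := tendsto_pure_nhds _ _
        exact tendsto_nhds_unique this hy
      · rw [nhds_discrete]; exact le_rfl
  have hP2 : IsClosedEmbedding P :=
    .of_continuous_injective_isClosedMap hprop.continuous hinj hprop.isClosedMap
  have hdisc : DiscreteTopology (range P) :=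
    (hP2.isEmbedding.toHomeomorph.symm.isEmbedding).discreteTopology
  refine ⟨range P, countable_range P, infinite_range_of_injective hinj, hP2.isClosed_range, hdisc,
    ⟨fun x => ((Equiv.ofInjective P hinj).symm x).2.toNat, continuous_of_discreteTopology⟩,
    ⟨1, ?_⟩, ?_⟩
  · intro x
    simp only [ContinuousMap.coe_mk]
    cases ((Equiv.ofInjective P hinj).symm x).2 <;> simp
  · rintro ⟨g, hg⟩
    have hg' : ∀ q, g (P q) = q.2.toNat := by
      intro q
      have := hg ⟨P q, mem_range_self q⟩
      have h2 : (Equiv.ofInjective P hinj).symm ⟨P q, mem_range_self q⟩ = q := by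
        rw [Equiv.symm_apply_eq]; rfl
      rw [this, ContinuousMap.coe_mk, h2]
    choose D0 hD0 hD1 using fun q => pa_locdep g (P q)
    let D : Set Omega1Index := ⋃ q, D0 q
    have hD : D.Countable := countable_iUnion hD0
    let C : Set Omega1Index := {α | σ (some α) ∈ D}
    have hC : C.Countable :=
      hD.preimage (f := fun α => σ (some α)) (σ.injective.comp (Option.some_injective _))
    obtain ⟨x, hx⟩ : ∃ x, x ∉ ⋃ α ∈ C, Z α := by
      by_contra hcon
      push Not at hcon
      exact hno ⟨C, hC, eq_univ_of_forall hcon⟩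
    simp only [mem_iUnion, not_exists, hu] at hx
    obtain ⟨p, hp, hp2⟩ := hh.2 (U x) (mem_range_self x)
    let w : Option Omega1Index → ℝ := fun o => o.elim 0 fun α => (1 - (u α x : ℝ))⁻¹
    let z : Omega1Index → ℝ := fun β => if β ∈ D then w (σ.symm β) else 0
    let Q : ℕ × Bool → (Omega1Index → ℝ) := fun q β => if β ∈ D then P q β else 0
    have hQ : ∀ q, g (Q q) = q.2.toNat := by
      intro q
      rw [← hg' q]
      refine hD1 q _ fun α hα => ?_
      have : α ∈ D := mem_iUnion.2 ⟨q, hα⟩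
      simp [Q, this]
    have hlim : ∀ i : Bool, Tendsto (fun n => Q (n, i)) p (𝓝 z) := by
      intro i
      rw [tendsto_pi_nhds]
      intro β
      by_cases hβ : β ∈ D
      · simp only [Q, z, hβ, if_true]
        obtain ⟨o, rfl⟩ := σ.surjective β
        rw [σ.symm_apply_apply]
        cases o with
        | none =>
          simp only [hPn, w, Option.elim]
          refine (hdecay.comp (?_ : Tendsto (fun n : ℕ => 2 * n + i.toNat) atTop atTop)).mono_left hp
          exact tendsto_atTop_mono (fun n => by simp only [id]; omega) tendsto_id
        | some α =>
          simp only [hPs, w, Option.elim]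
          have h1 : Tendsto (fun n : ℕ => (h α n : ℝ)) p (𝓝 (u α x)) :=
            (continuous_subtype_val.tendsto _).comp (hp2 α trivial)
          have h3 : Tendsto (fun n : ℕ => 1 - (h α n : ℝ) + 1 / ((n : ℝ) + 1)) p
              (𝓝 (1 - (u α x : ℝ))) := by
            simpa using (h1.const_sub 1).add (hdecay.mono_left hp)
          exact h3.inv₀ (sub_ne_zero.2 (Ne.symm (hx α hβ)))
      · simp only [Q, z, hβ, if_false]
        exact tendsto_const_nhds
    have hval : ∀ i : Bool, g z = i.toNat := by
      intro i
      have h1 := (g.continuous.tendsto z).comp (hlim i)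
      refine tendsto_nhds_unique h1 ?_
      refine tendsto_const_nhds.congr fun n => ?_
      exact (hQ (n, i)).symm
    have h0 := hval false
    have h1 := hval true
    simp [h0] at h1

/-- The following are equivalent:
(1) there is a countably infinite closed discrete subset of `ℝ^{ω₁}` that is not
`C*`-embedded in `ℝ^{ω₁}`;
(2) there is a nonempty compact Hausdorff space with a family of `ℵ₁` many closed `Gδ`
subsets covering it, such that no countable subfamily covers it. -/
theorem closed_copy_not_Cstar_iff_pseudoAronszajn :
    (∃ N : Set (Omega1Index → ℝ),
      N.Countable ∧ N.Infinite ∧ IsClosed N ∧ DiscreteTopology N ∧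
      ∃ f : C(N, ℝ), (∃ M : ℝ, ∀ x : N, |f x| ≤ M) ∧
        ¬ ∃ g : C((Omega1Index → ℝ), ℝ), ∀ x : N, g x.val = f x)
    ↔
    (∃ (X : Type) (_ : TopologicalSpace X), CompactSpace X ∧ T2Space X ∧ Nonempty X ∧
      ∃ Z : Omega1Index → Set X,
        (∀ α, IsClosed (Z α)) ∧ (∀ α, IsGδ (Z α)) ∧ (⋃ α, Z α) = Set.univ ∧
        ¬ ∃ C : Set Omega1Index, C.Countable ∧ (⋃ α ∈ C, Z α) = Set.univ) := by
  constructor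
  · rintro ⟨N, h1, h2, h3, h4, f, -, hf⟩
    exact pa_dir1 N h1 h2 h3 h4 f hf
  · rintro ⟨X, _, _, _, _, Z, h1, h2, h3, h4⟩
    exact pa_dir2 X Z h1 h2 h3 h4
end

section
/- The following are equivalent: (1) there exists a nonempty compact Hausdorff space X with a family of ℵ₁ many closed Gδ subsets of X whose union is X such that no countable subfamily has union X; (2) the space ℕ* admits a family of ℵ₁ many zero-sets whose union is ℕ* such that no countable subfamily has union ℕ*. -/
open Set Ordinal

/-- `ℕ*`, the Stone–Čech remainder of the discrete space `ℕ`. -/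
abbrev NStar : Type := ((Set.range (stoneCechUnit : ℕ → StoneCech ℕ))ᶜ : Set (StoneCech ℕ))

section Helpers

open Filter Topology

/-- The sequences `a ξ`, `ξ ∈ S`, cluster (jointly) exactly at the points of the image of `X`
under `(f ξ)`, `ξ ∈ S`; expressed through finite sets of coordinates. -/
def GoodFam {I X M : Type*} [PseudoMetricSpace M] (f : I → X → M) (a : I → ℕ → M)
    (S : Set I) : Prop :=
  ∀ F : Finset I, (∀ ξ ∈ F, ξ ∈ S) → ∀ ε : ℝ, 0 < ε →
    (∀ᶠ n in atTop, ∃ x, ∀ ξ ∈ F, dist (a ξ n) (f ξ x) < ε) ∧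
    ∀ x, ∃ᶠ n in atTop, ∀ ξ ∈ F, dist (a ξ n) (f ξ x) < ε

theorem GoodFam.congr {I X M : Type*} [PseudoMetricSpace M] {f : I → X → M} {a a' : I → ℕ → M}
    {S : Set I} (h : GoodFam f a S) (haa : ∀ ξ ∈ S, a ξ = a' ξ) : GoodFam f a' S := by
  intro F hF ε hε
  obtain ⟨h1, h2⟩ := h F hF ε hε
  refine ⟨h1.mono ?_, fun x => (h2 x).mono ?_⟩
  · rintro n ⟨x, hx⟩
    exact ⟨x, fun ξ hξ => by rw [← haa ξ (hF ξ hξ)]; exact hx ξ hξ⟩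
  · intro n hx ξ hξ
    rw [← haa ξ (hF ξ hξ)]; exact hx ξ hξ

theorem exists_diag {X : Type*} [Nonempty X] (Q : ℕ → X → ℕ → Prop)
    (hmono : ∀ k k' y n, k ≤ k' → Q k' y n → Q k y n)
    (h : ∀ k, ∀ᶠ n in atTop, ∃ y, Q k y n) :
    ∃ y : ℕ → X, ∀ k, ∀ᶠ n in atTop, Q k (y n) n := by
  classical
  let K : ℕ → ℕ := fun n => Nat.findGreatest (fun k => ∃ y, Q k y n) n
  refine ⟨fun n => if h : ∃ y, Q (K n) y n then h.choose else Classical.arbitrary X, ?_⟩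
  intro k
  filter_upwards [h k, eventually_ge_atTop k] with n hn hkn
  have h1 : ∃ y, Q (K n) y n := Nat.findGreatest_spec (P := fun k => ∃ y, Q k y n) hkn hn
  have h2 : k ≤ K n := Nat.le_findGreatest hkn hn
  rw [dif_pos h1]
  exact hmono _ _ _ _ h2 h1.choose_spec

theorem exists_dense_points {X T : Type*} [Nonempty X] [TopologicalSpace T]
    [SecondCountableTopology T] (Φ : X → T) :
    ∃ x : ℕ → X, ∀ y, ∀ U ∈ 𝓝 (Φ y), ∃ k, Φ (x k) ∈ U := by
  obtain ⟨u, hu⟩ := TopologicalSpace.exists_dense_seq (Set.range Φ)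
  choose x hx using fun k => (u k).2
  refine ⟨x, fun y U hU => ?_⟩
  have h1 : (Subtype.val ⁻¹' U : Set (Set.range Φ)) ∈ 𝓝 (⟨Φ y, y, rfl⟩ : Set.range Φ) :=
    continuous_subtype_val.continuousAt.preimage_mem_nhds hU
  obtain ⟨_, hz, k, rfl⟩ := mem_closure_iff_nhds.1 (hu ⟨Φ y, y, rfl⟩) _ h1
  exact ⟨k, by rw [hx]; exact hz⟩

theorem GoodFam.step {I X M : Type*} [Nonempty X] [PseudoMetricSpace M]
    [SecondCountableTopology M] {f : I → X → M} {a : I → ℕ → M} {S : Set I}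
    (hS : S.Countable) (h : GoodFam f a S) (α : I) :
    ∃ b : ℕ → M, ∀ a' : I → ℕ → M, (∀ ξ ∈ S, a' ξ = a ξ) → a' α = b →
      GoodFam f a' (insert α S) := by
  classical
  obtain ⟨e, he⟩ := Set.countable_iff_exists_injOn.1 hS
  have hfin : ∀ k, {ξ | ξ ∈ S ∧ e ξ ≤ k}.Finite := by
    intro k
    refine Set.Finite.of_finite_image (f := e) ((Set.finite_Iic k).subset ?_) ?_
    · rintro _ ⟨ξ, hξ, rfl⟩; exact hξ.2
    · exact he.mono fun ξ hξ => hξ.1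
  let Q : ℕ → X → ℕ → Prop := fun k y n =>
    ∀ ξ ∈ S, e ξ ≤ k → dist (a ξ n) (f ξ y) < 1 / ((k : ℝ) + 1)
  have hpos : ∀ k : ℕ, (0 : ℝ) < 1 / ((k : ℝ) + 1) := fun k => by positivity
  have Qmono : ∀ k k' y n, k ≤ k' → Q k' y n → Q k y n := by
    intro k k' y n hk hQ ξ hξ hek
    exact (hQ ξ hξ (hek.trans hk)).trans_le (Nat.one_div_le_one_div hk)
  have QA : ∀ k, ∀ᶠ n in atTop, ∃ y, Q k y n := by
    intro k
    refine (h (hfin k).toFinset (by simp +contextual) _ (hpos k)).1.mono ?_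
    rintro n ⟨y, hy⟩
    exact ⟨y, fun ξ hξ hk => hy ξ (by simp [hξ, hk])⟩
  have QB : ∀ k y, ∃ᶠ n in atTop, Q k y n := by
    intro k y
    refine ((h (hfin k).toFinset (by simp +contextual) _ (hpos k)).2 y).mono ?_
    intro n hy ξ hξ hk
    exact hy ξ (by simp [hξ, hk])
  have Qfin : ∀ (F : Finset I), (∀ ξ ∈ F, ξ ∈ insert α S) → ∀ ε : ℝ, 0 < ε →
      ∃ k, ∀ k' y n, k ≤ k' → Q k' y n → ∀ ξ ∈ F, ξ ∈ S → dist (a ξ n) (f ξ y) < ε := by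
    intro F hF ε hε
    obtain ⟨k0, hk0⟩ := exists_nat_one_div_lt hε
    refine ⟨max k0 (F.sup e), fun k' y n hk' hQ ξ hξ hξS => ?_⟩
    refine lt_trans ?_ hk0
    refine (hQ ξ hξS ((Finset.le_sup hξ).trans ((le_max_right _ _).trans hk'))).trans_le ?_
    exact Nat.one_div_le_one_div ((le_max_left _ _).trans hk')
  obtain ⟨y, hy⟩ := exists_diag Q Qmono QA
  have : Countable S := hS.to_subtype
  obtain ⟨x, hx⟩ := exists_dense_points
    (fun z : X => ((fun ξ : S => f ξ z, f α z) : (S → M) × M))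
  obtain ⟨φ, hφ, hφQ⟩ := extraction_forall_of_frequently
    (P := fun j n => Q j (x j.unpair.1) n) (fun j => QB j _)
  let y' : ℕ → X := fun n => if h : ∃ j, φ j = n then x (h.choose).unpair.1 else y n
  have hy'φ : ∀ j, y' (φ j) = x j.unpair.1 := by
    intro j
    have hj : ∃ i, φ i = φ j := ⟨j, rfl⟩
    have : hj.choose = j := hφ.injective hj.choose_spec
    simp only [y']
    rw [dif_pos hj, this]
  have hy' : ∀ k, ∀ᶠ n in atTop, Q k (y' n) n := by
    intro k
    filter_upwards [hy k, eventually_gt_atTop (φ k)] with n hn hkn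
    by_cases hj : ∃ j, φ j = n
    · obtain ⟨j, rfl⟩ := hj
      rw [hy'φ]
      exact Qmono k j _ _ (hφ.lt_iff_lt.1 hkn).le (hφQ j)
    · simp only [y']
      rw [dif_neg hj]; exact hn
  by_cases hαS : α ∈ S
  · refine ⟨a α, fun a' ha' _ => ?_⟩
    rw [Set.insert_eq_of_mem hαS]
    exact h.congr fun ξ hξ => (ha' ξ hξ).symm
  refine ⟨fun n => f α (y' n), fun a' ha' hα F hF ε hε => ⟨?_, ?_⟩⟩
  · obtain ⟨k, hk⟩ := Qfin F hF ε hε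
    filter_upwards [hy' k] with n hn
    refine ⟨y' n, fun ξ hξ => ?_⟩
    rcases hF ξ hξ with rfl | hξS
    · rw [hα]; simpa using hε
    · rw [ha' ξ hξS]; exact hk k _ _ le_rfl hn ξ hξ hξS
  · intro z
    obtain ⟨k, hk⟩ := Qfin F hF (ε / 2) (by positivity)
    have hU : ∀ᶠ w in 𝓝 ((fun ξ : S => f ξ z, f α z) : (S → M) × M),
        (∀ ξ ∈ F.subtype (· ∈ S), dist (w.1 ξ) (f ξ z) < ε / 2) ∧ dist w.2 (f α z) < ε / 2 := by
      refine Filter.Eventually.and ?_ ?_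
      · rw [Filter.eventually_all_finset]
        intro ξ _
        have hc : Continuous fun w : (S → M) × M => dist (w.1 ξ) (f ξ z) := by fun_prop
        exact hc.continuousAt.eventually (Iio_mem_nhds (by simpa using hε))
      · have hc : Continuous fun w : (S → M) × M => dist w.2 (f α z) := by fun_prop
        exact hc.continuousAt.eventually (Iio_mem_nhds (by simpa using hε))
    obtain ⟨m, hm1, hm2⟩ := hx z _ hU
    rw [Filter.frequently_atTop]
    intro N
    set j := Nat.pair m (max N k) with hj
    have hjk : max N k ≤ j := Nat.right_le_pair _ _
    have hju : j.unpair.1 = m := by rw [hj, Nat.unpair_pair]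
    refine ⟨φ j, ((le_max_left _ _).trans hjk).trans (hφ.id_le j), fun ξ hξ => ?_⟩
    rcases hF ξ hξ with rfl | hξS
    · rw [hα]
      simp only [hy'φ, hju]
      exact hm2.trans (by linarith)
    · rw [ha' ξ hξS]
      have h1 := hk j _ _ ((le_max_right _ _).trans hjk) (hφQ j) ξ hξ hξS
      rw [hju] at h1
      have h2 := hm1 ⟨ξ, hξS⟩ (by simpa using hξ)
      exact (dist_triangle _ _ _).trans_lt (by simp only at h2; linarith)

theorem goodFam_of_Iic {I X M : Type*} [LinearOrder I] [Nonempty X] [PseudoMetricSpace M]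
    {f : I → X → M} {a : I → ℕ → M} {S : Set I} (h : ∀ α ∈ S, GoodFam f a (Set.Iic α)) :
    GoodFam f a S := by
  intro F hF ε hε
  rcases F.eq_empty_or_nonempty with rfl | hne
  · simp; infer_instance
  · exact h (F.max' hne) (hF _ (F.max'_mem hne)) F (fun ξ hξ => F.le_max' ξ hξ) ε hε

theorem exists_goodFam {I X M : Type*} [LinearOrder I] [WellFoundedLT I]
    (hI : ∀ α : I, (Set.Iio α).Countable) [Nonempty X] [Nonempty M] [PseudoMetricSpace M]
    [SecondCountableTopology M] (f : I → X → M) :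
    ∃ a : I → ℕ → M, GoodFam f a Set.univ := by
  classical
  let G : (α : I) → ((ξ : I) → ξ < α → ℕ → M) → (ℕ → M) → I → ℕ → M :=
    fun α prev b ξ => if hξ : ξ < α then prev ξ hξ else b
  let step : (α : I) → ((ξ : I) → ξ < α → ℕ → M) → ℕ → M := fun α prev =>
    if h : ∃ b, GoodFam f (G α prev b) (Set.Iic α) then h.choose else fun _ => Classical.arbitrary M
  let a : I → ℕ → M := (wellFounded_lt (α := I)).fix step
  have ha : ∀ α, a α = step α (fun ξ _ => a ξ) := fun α => WellFounded.fix_eq _ _ _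
  have key : ∀ α, GoodFam f a (Set.Iic α) := by
    intro α
    induction α using WellFoundedLT.induction with
    | ind α ih =>
      have h1 : GoodFam f a (Set.Iio α) := goodFam_of_Iic ih
      obtain ⟨b, hb⟩ := h1.step (hI α) α
      have h2 : ∃ b, GoodFam f (G α (fun ξ _ => a ξ) b) (Set.Iic α) := by
        refine ⟨b, ?_⟩
        rw [← Set.Iio_insert]
        refine hb _ ?_ ?_
        · intro ξ hξ
          exact dif_pos (Set.mem_Iio.1 hξ)
        · simp [G]
      have h3 : a α = h2.choose := by
        rw [ha]; simp only [step]; rw [dif_pos h2]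
      refine h2.choose_spec.congr ?_
      intro ξ hξ
      rcases lt_or_eq_of_le hξ with hlt | rfl
      · simp only [G]; rw [dif_pos hlt]
      · rw [h3]; simp [G]
  exact ⟨a, goodFam_of_Iic fun α _ => key α⟩

theorem stoneCechUnit_nat_injective : Function.Injective (stoneCechUnit : ℕ → StoneCech ℕ) := by
  intro m n h
  have := eq_if_stoneCechUnit_eq (f := fun k : ℕ => decide (k = m))
    continuous_of_discreteTopology h
  simpa [eq_comm] using this

theorem isOpen_singleton_unit (m : ℕ) : IsOpen ({stoneCechUnit m} : Set (StoneCech ℕ)) := by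
  have hc : Continuous (fun k : ℕ => decide (k = m)) := continuous_of_discreteTopology
  have hU : IsOpen (stoneCechExtend hc ⁻¹' {true}) :=
    (isOpen_discrete _).preimage (continuous_stoneCechExtend hc)
  have : ({stoneCechUnit m} : Set (StoneCech ℕ)) = stoneCechExtend hc ⁻¹' {true} := by
    apply Set.Subset.antisymm
    · rintro _ rfl
      simp [stoneCechExtend_stoneCechUnit]
    · refine (denseRange_stoneCechUnit.open_subset_closure_inter hU).trans ?_
      refine closure_minimal ?_ isClosed_singleton
      rintro _ ⟨h1, k, rfl⟩
      simp [stoneCechExtend_stoneCechUnit] at h1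
      simp [h1]
  rw [this]; exact hU

theorem isClosed_nstar : IsClosed ((Set.range (stoneCechUnit : ℕ → StoneCech ℕ))ᶜ) := by
  rw [isClosed_compl_iff, ← Set.iUnion_singleton_eq_range]
  exact isOpen_iUnion isOpen_singleton_unit

theorem nstar_frequently {p : StoneCech ℕ} (hp : p ∉ Set.range (stoneCechUnit : ℕ → StoneCech ℕ))
    {U : Set (StoneCech ℕ)} (hU : U ∈ 𝓝 p) : ∃ᶠ n in atTop, stoneCechUnit n ∈ U := by
  rw [Filter.frequently_atTop]
  intro N
  have hfin : (stoneCechUnit '' Set.Iio N : Set (StoneCech ℕ)).Finite :=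
    (Set.finite_Iio N).image _
  have hmem : (stoneCechUnit '' Set.Iio N : Set (StoneCech ℕ))ᶜ ∈ 𝓝 p := by
    refine hfin.isClosed.isOpen_compl.mem_nhds ?_
    rintro ⟨n, _, rfl⟩
    exact hp ⟨n, rfl⟩
  obtain ⟨_, ⟨h1, h2⟩, n, rfl⟩ := mem_closure_iff_nhds.1 (denseRange_stoneCechUnit p) _
    (Filter.inter_mem hU hmem)
  refine ⟨n, ?_, h1⟩
  by_contra hlt
  exact h2 ⟨n, not_le.1 hlt, rfl⟩

theorem exists_nstar_of_frequently {P : ℕ → Prop} (hP : ∃ᶠ n in atTop, P n) :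
    ∃ p : StoneCech ℕ, p ∉ Set.range (stoneCechUnit : ℕ → StoneCech ℕ) ∧
      ∀ U ∈ 𝓝 p, ∃ n, P n ∧ stoneCechUnit n ∈ U := by
  have : NeBot (atTop ⊓ 𝓟 {n | P n}) := Filter.frequently_mem_iff_neBot.1 hP
  obtain ⟨p, hp⟩ := exists_clusterPt_of_compactSpace
    (Filter.map (stoneCechUnit : ℕ → StoneCech ℕ) (atTop ⊓ 𝓟 {n | P n}))
  have key : ∀ U ∈ 𝓝 p, ∀ N, ∃ n, N ≤ n ∧ P n ∧ stoneCechUnit n ∈ U := by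
    intro U hU N
    have h1 : stoneCechUnit '' {n | N ≤ n ∧ P n} ∈
        Filter.map (stoneCechUnit : ℕ → StoneCech ℕ) (atTop ⊓ 𝓟 {n | P n}) :=
      Filter.image_mem_map (Filter.inter_mem_inf (Filter.mem_atTop N) (Filter.mem_principal_self _))
    obtain ⟨_, hU', n, ⟨hN, hPn⟩, rfl⟩ := clusterPt_iff_nonempty.1 hp hU h1
    exact ⟨n, hN, hPn, hU'⟩
  refine ⟨p, ?_, fun U hU => ?_⟩
  · rintro ⟨m, rfl⟩
    obtain ⟨n, hn, _, h⟩ := key _ ((isOpen_singleton_unit m).mem_nhds rfl) (m + 1)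
    have := stoneCechUnit_nat_injective h
    omega
  · obtain ⟨n, _, h⟩ := key U hU 0
    exact ⟨n, h⟩

theorem countable_Iio_omega1 (α : Omega1Index) : (Set.Iio α).Countable := by
  have h : (Set.Iio α.1).Countable := by
    obtain ⟨o, h1⟩ := α
    rw [← Cardinal.ord_aleph, Cardinal.lt_ord, ← Cardinal.succ_aleph0, Order.lt_succ_iff] at h1
    rw [← Cardinal.le_aleph0_iff_set_countable, Cardinal.mk_Iio_ordinal]
    exact Cardinal.lift_le_aleph0.2 h1
  exact (h.preimage Subtype.val_injective).mono fun β hβ => hβ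

/-- Parametrized closeness sets have the finite intersection property. -/
theorem exists_common {I Y M : Type*} [TopologicalSpace Y] [MetricSpace M] {s : Set Y}
    (hs : IsCompact s) (g : I → Y → M) (hg : ∀ ξ, Continuous (g ξ)) (c : I → M)
    (h : ∀ F : Finset I, ∀ ε : ℝ, 0 < ε → ∃ y ∈ s, ∀ ξ ∈ F, dist (g ξ y) (c ξ) ≤ ε) :
    ∃ y ∈ s, ∀ ξ, g ξ y = c ξ := by
  classical
  obtain ⟨y, hy, hy'⟩ := hs.inter_iInter_nonempty
    (fun i : I × ℕ => {y | dist (g i.1 y) (c i.1) ≤ 1 / ((i.2 : ℝ) + 1)})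
    (fun i => isClosed_le ((hg _).dist continuous_const) continuous_const) (by
      intro u
      obtain ⟨y, hy, hy'⟩ := h (u.image Prod.fst) (1 / (((u.sup Prod.snd : ℕ) : ℝ) + 1))
        (by positivity)
      refine ⟨y, hy, ?_⟩
      simp only [Set.mem_iInter, Set.mem_ofPred_eq]
      intro i hi
      exact (hy' i.1 (Finset.mem_image_of_mem _ hi)).trans
        (Nat.one_div_le_one_div (Finset.le_sup (f := Prod.snd) hi)))
  refine ⟨y, hy, fun ξ => ?_⟩
  simp only [Set.mem_iInter, Set.mem_ofPred_eq] at hy'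
  rw [← dist_le_zero]
  refine le_of_forall_pos_le_add fun ε hε => ?_
  obtain ⟨k, hk⟩ := exists_nat_one_div_lt hε
  have := hy' (ξ, k)
  simp only at this
  linarith

/-- Parovichenko's theorem in the form needed here. -/
theorem parovichenko {I X M : Type*} [LinearOrder I] [WellFoundedLT I]
    (hI : ∀ α : I, (Set.Iio α).Countable) [TopologicalSpace X] [CompactSpace X] [Nonempty X]
    [MetricSpace M] [CompactSpace M] (f : I → X → M) (hf : ∀ ξ, Continuous (f ξ)) :
    ∃ g : I → NStar → M, (∀ ξ, Continuous (g ξ)) ∧ (∀ p, ∃ x, ∀ ξ, f ξ x = g ξ p) ∧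
      ∀ x, ∃ p, ∀ ξ, g ξ p = f ξ x := by
  rcases isEmpty_or_nonempty M with hM | hM
  · have : IsEmpty I := ⟨fun ξ => hM.elim (f ξ (Classical.arbitrary X))⟩
    refine ⟨fun ξ => this.elim ξ, fun ξ => this.elim ξ,
      fun p => ⟨Classical.arbitrary X, fun ξ => this.elim ξ⟩, fun x => ?_⟩
    obtain ⟨p, hp, _⟩ := exists_nstar_of_frequently (P := fun _ => True) (by simp; infer_instance)
    exact ⟨⟨p, hp⟩, fun ξ => this.elim ξ⟩
  obtain ⟨a, ha⟩ := exists_goodFam hI f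
  have hc : ∀ ξ, Continuous (a ξ) := fun ξ => continuous_of_discreteTopology
  have hg := fun ξ => continuous_stoneCechExtend (hc ξ)
  refine ⟨fun ξ p => stoneCechExtend (hc ξ) p.1, fun ξ => (hg ξ).comp continuous_subtype_val,
    ?_, ?_⟩
  · rintro ⟨p, hp⟩
    obtain ⟨x, _, hx⟩ := exists_common (isCompact_univ (X := X)) f hf
      (fun ξ => stoneCechExtend (hc ξ) p) (by
        intro F ε hε
        have hU : ∀ᶠ q in 𝓝 p, ∀ ξ ∈ F,
            dist (stoneCechExtend (hc ξ) q) (stoneCechExtend (hc ξ) p) < ε / 2 := by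
          rw [Filter.eventually_all_finset]
          intro ξ _
          exact (hg ξ).continuousAt.eventually (Metric.ball_mem_nhds _ (by positivity))
        obtain ⟨n, hn, x, hx⟩ := ((nstar_frequently hp hU).and_eventually
          (ha F (fun _ _ => Set.mem_univ _) (ε / 2) (by positivity)).1).exists
        refine ⟨x, Set.mem_univ _, fun ξ hξ => ?_⟩
        have h1 := hn ξ hξ
        have h2 := hx ξ hξ
        rw [stoneCechExtend_stoneCechUnit] at h1
        rw [dist_comm] at h2
        exact (dist_triangle _ _ _).trans (by linarith))
    exact ⟨x, hx⟩
  · intro x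
    obtain ⟨p, hp, hx⟩ := exists_common isClosed_nstar.isCompact
      (fun ξ => stoneCechExtend (hc ξ)) hg (fun ξ => f ξ x) (by
        intro F ε hε
        obtain ⟨p, hp, h⟩ := exists_nstar_of_frequently
          ((ha F (fun _ _ => Set.mem_univ _) ε hε).2 x)
        refine ⟨p, hp, fun ξ hξ => ?_⟩
        by_contra hlt
        have hV : {q | ε < dist (stoneCechExtend (hc ξ) q) (f ξ x)} ∈ 𝓝 p :=
          (isOpen_lt continuous_const ((hg ξ).dist continuous_const)).mem_nhds (not_le.1 hlt)
        obtain ⟨n, hn, hn'⟩ := h _ hV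
        simp only [Set.mem_ofPred_eq, stoneCechExtend_stoneCechUnit] at hn'
        exact absurd (hn ξ hξ) (not_lt.2 hn'.le))
    exact ⟨⟨p, hp⟩, hx⟩

end Helpers

/-- The existence of a nonempty compact Hausdorff space with a cover by `ℵ₁` many closed
`Gδ` sets having no countable subcover is equivalent to the existence of a cover of `ℕ*`
by `ℵ₁` many zero-sets having no countable subcover. -/
theorem pseudoAronszajn_iff_cover_of_NStar :
    (∃ (X : Type) (_ : TopologicalSpace X), CompactSpace X ∧ T2Space X ∧ Nonempty X ∧
      ∃ Z : Omega1Index → Set X,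
        (∀ α, IsClosed (Z α)) ∧ (∀ α, IsGδ (Z α)) ∧ (⋃ α, Z α) = Set.univ ∧
        ¬ ∃ C : Set Omega1Index, C.Countable ∧ (⋃ α ∈ C, Z α) = Set.univ)
    ↔
    (∃ Z : Omega1Index → Set NStar,
      (∀ α, ∃ g : C(NStar, ℝ), Z α = g ⁻¹' {0}) ∧ (⋃ α, Z α) = Set.univ ∧
      ¬ ∃ C : Set Omega1Index, C.Countable ∧ (⋃ α ∈ C, Z α) = Set.univ) := by
  constructor
  · rintro ⟨X, _, hX1, hX2, hX3, Z, hZc, hZg, hZu, hZn⟩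
    choose f hf _ _ hf01 using fun α => exists_continuous_one_zero_of_isCompact_of_isGδ
      (hZc α).isCompact (hZg α) isClosed_empty (Set.disjoint_empty _)
    obtain ⟨g, hg, h1, h2⟩ := parovichenko countable_Iio_omega1
      (fun α x => (⟨f α x, hf01 α x⟩ : Set.Icc (0 : ℝ) 1))
      (fun α => (f α).continuous.subtype_mk _)
    have hZmem : ∀ α x, x ∈ Z α ↔ f α x = 1 := fun α x => by
      rw [hf α]; rfl
    refine ⟨fun α => {p | (g α p : ℝ) = 1}, fun α => ?_, ?_, ?_⟩
    · refine ⟨⟨fun p => (g α p : ℝ) - 1,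
        (continuous_subtype_val.comp (hg α)).sub continuous_const⟩, ?_⟩
      ext p
      simp [sub_eq_zero]
    · rw [Set.eq_univ_iff_forall]
      intro p
      obtain ⟨x, hx⟩ := h1 p
      obtain ⟨α, hα⟩ := Set.mem_iUnion.1 (hZu.symm ▸ Set.mem_univ x : x ∈ ⋃ α, Z α)
      refine Set.mem_iUnion.2 ⟨α, ?_⟩
      simp only [Set.mem_ofPred_eq]
      rw [← hx α]
      exact (hZmem α x).1 hα
    · rintro ⟨C, hC, hCu⟩
      refine hZn ⟨C, hC, ?_⟩
      rw [Set.eq_univ_iff_forall] at hCu ⊢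
      intro x
      obtain ⟨p, hp⟩ := h2 x
      obtain ⟨α, hα, hpα⟩ := Set.mem_iUnion₂.1 (hCu p)
      refine Set.mem_iUnion₂.2 ⟨α, hα, (hZmem α x).2 ?_⟩
      simp only [Set.mem_ofPred_eq] at hpα
      rw [hp α] at hpα
      exact hpα
  · rintro ⟨Z, hZ, hZu, hZn⟩
    refine ⟨NStar, inferInstance, isCompact_iff_compactSpace.1 isClosed_nstar.isCompact,
      inferInstance, ?_, Z, ?_, ?_, hZu, hZn⟩
    · by_contra hne
      rw [not_nonempty_iff] at hne
      exact hZn ⟨∅, Set.countable_empty, Subsingleton.elim _ _⟩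
    · intro α
      obtain ⟨g, hg⟩ := hZ α
      rw [hg]
      exact isClosed_singleton.preimage g.continuous
    · intro α
      obtain ⟨g, hg⟩ := hZ α
      rw [hg]
      exact (isClosed_singleton.isGδ).preimage g.continuous
end

section
/- Assume 𝔡 = 𝔲 = ℵ₁, in the form: (i) there is a family D of functions ℕ → ℕ with |D| ≤ ℵ₁ such that for every g : ℕ → ℕ there is f ∈ D with g(n) ≤ f(n) for all n; and (ii) there is a free (nonprincipal) ultrafilter on ℕ generated by a filter base of cardinality at most ℵ₁. Then there exists a closed subset B of ℝ^{ω₁} of cardinality ℵ₁ and a countably infinite subset N of B such that N is closed in B and discrete in the subspace topology, N is C*-embedded in B (every bounded continuous function N → ℝ extends continuously to B), but N is not C-embedded in B (some continuous function N → ℝ has no continuous extension to B). -/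
open Set

namespace CStarEx

open Filter Topology

/-- The combinatorial data used in the construction. -/
structure Dat where
  x : Omega1Index → ℕ → ℕ
  F : Omega1Index → List ℕ → ℕ
  u : Ultrafilter ℕ
  d : Omega1Index → ℕ → ℕ
  e : Omega1Index → ℕ → Omega1Index
  A : Omega1Index → Set ℕ
  x_inj : Function.Injective x
  x_not_le : ∀ α β, α < β → ∃ i, d α i < x β i
  e_range : ∀ α β, β ≤ α → ∃ i, e α i = β
  d_dom : ∀ g : ℕ → ℕ, ∃ α, ∀ n, g n ≤ d α n
  F_dom : ∀ g : List ℕ → ℕ, ∃ α, ∀ s, g s ≤ F α s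
  u_free : (u : Filter ℕ) ≤ atTop
  A_mem : ∀ ξ, A ξ ∈ u
  A_gen : ∀ v : Ultrafilter ℕ, (∀ ξ, A ξ ∈ v) → v = u

/-- The points of the space. -/
inductive Yp (D : Dat) : Type 1
  | pt (s : List ℕ) (k : ℕ) : Yp D
  | lim (s : List ℕ) : Yp D
  | inf (β : Omega1Index) : Yp D

variable (D : Dat)

/-- The branch of `x β`. -/
def br (β : Omega1Index) (n : ℕ) : List ℕ := (List.range n).map (D.x β)

/-- The sequence converging to `inf β` along `u`. -/
def sq (β : Omega1Index) (n : ℕ) : Yp D := Yp.pt (br D β n) (D.F β (br D β n))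

theorem br_length (β : Omega1Index) (n : ℕ) : (br D β n).length = n := by simp [br]

theorem br_get (β : Omega1Index) (n j : ℕ) (h : j < n) : (br D β n)[j]? = some (D.x β j) := by
  simp [br, h]

theorem br_ne {β γ : Omega1Index} (h : β ≠ γ) : ∃ m, ∀ n, m < n → br D β n ≠ br D γ n := by
  have : D.x β ≠ D.x γ := fun h' => h (D.x_inj h')
  obtain ⟨m, hm⟩ := Function.ne_iff.1 this
  refine ⟨m, fun n hn h' => hm ?_⟩
  have := congrArg (fun l => l[m]?) h'
  simpa [br_get D _ n m hn] using this

instance : TopologicalSpace (Yp D) where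
  IsOpen U := (∀ s, Yp.lim s ∈ U → ∀ᶠ k in atTop, Yp.pt s k ∈ U) ∧
    ∀ β, Yp.inf β ∈ U → ∀ᶠ n in (D.u : Filter ℕ), sq D β n ∈ U
  isOpen_univ := by simp
  isOpen_inter U V hU hV := by
    refine ⟨fun s hs => ?_, fun s hs => ?_⟩
    · filter_upwards [hU.1 s hs.1, hV.1 s hs.2] with k h1 h2 using ⟨h1, h2⟩
    · filter_upwards [hU.2 s hs.1, hV.2 s hs.2] with k h1 h2 using ⟨h1, h2⟩
  isOpen_sUnion S hS := by
    refine ⟨fun s hs => ?_, fun s hs => ?_⟩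
    · obtain ⟨U, hU, h⟩ := hs
      filter_upwards [(hS U hU).1 s h] with k h1 using ⟨U, hU, h1⟩
    · obtain ⟨U, hU, h⟩ := hs
      filter_upwards [(hS U hU).2 s h] with k h1 using ⟨U, hU, h1⟩

variable {D}

theorem isOpen_iff' {U : Set (Yp D)} : IsOpen U ↔
    (∀ s, Yp.lim s ∈ U → ∀ᶠ k in atTop, Yp.pt s k ∈ U) ∧
    ∀ β, Yp.inf β ∈ U → ∀ᶠ n in (D.u : Filter ℕ), sq D β n ∈ U := Iff.rfl

theorem tendsto_pt (s : List ℕ) : Tendsto (fun k => (Yp.pt s k : Yp D)) atTop (𝓝 (Yp.lim s)) := by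
  refine tendsto_nhds.2 fun U hU h => hU.1 s h

theorem tendsto_sq (β : Omega1Index) : Tendsto (sq D β) D.u (𝓝 (Yp.inf β)) := by
  refine tendsto_nhds.2 fun U hU h => hU.2 β h

theorem continuous_of {X : Type*} [TopologicalSpace X] {f : Yp D → X}
    (h1 : ∀ s, Tendsto (fun k => f (Yp.pt s k)) atTop (𝓝 (f (Yp.lim s))))
    (h2 : ∀ β, Tendsto (fun n => f (sq D β n)) D.u (𝓝 (f (Yp.inf β)))) : Continuous f := by
  refine continuous_def.2 fun U hU => isOpen_iff'.2 ⟨fun s hs => ?_, fun β hβ => ?_⟩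
  · exact (h1 s).eventually (hU.mem_nhds hs)
  · exact (h2 β).eventually (hU.mem_nhds hβ)

theorem ev_u {P : ℕ → Prop} (m : ℕ) (h : ∀ n, m < n → P n) : ∀ᶠ n in (D.u : Filter ℕ), P n := by
  filter_upwards [D.u_free (Ioi_mem_atTop m)] with n hn using h n hn

theorem continuous_nat {f : Yp D → ℕ}
    (h1 : ∀ s, ∀ᶠ k in atTop, f (Yp.pt s k) = f (Yp.lim s))
    (h2 : ∀ β, ∀ᶠ n in (D.u : Filter ℕ), f (sq D β n) = f (Yp.inf β)) :
    Continuous f := by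
  refine continuous_of (fun s => ?_) (fun β => ?_)
  · exact tendsto_const_nhds.congr' (by filter_upwards [h1 s] with k hk using hk.symm)
  · exact tendsto_const_nhds.congr' (by filter_upwards [h2 β] with k hk using hk.symm)

/-- Coordinates of a point. -/
def val : Yp D → ℕ → Option ℕ
  | Yp.pt s _, j => s[j]?
  | Yp.lim s, j => s[j]?
  | Yp.inf β, j => some (D.x β j)

/-- The clopen graph of `F β` over the branch. -/
def Gr (β : Omega1Index) : Yp D → Prop
  | Yp.pt s k => s = br D β s.length ∧ k = D.F β s
  | Yp.lim _ => False
  | Yp.inf γ => γ = β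

open Classical in
/-- indicator of an isolated point -/
noncomputable def single (p : List ℕ × ℕ) (y : Yp D) : ℕ := if y = Yp.pt p.1 p.2 then 1 else 0

open Classical in
/-- indicator of a column -/
noncomputable def col (s : List ℕ) : Yp D → ℕ
  | Yp.pt s' _ => if s' = s then 1 else 0
  | Yp.lim s' => if s' = s then 1 else 0
  | Yp.inf _ => 0

open Classical in
/-- indicator of a graph -/
noncomputable def gr (β : Omega1Index) (y : Yp D) : ℕ := if Gr β y then 1 else 0

/-- coordinate function -/
def J (j : ℕ) (y : Yp D) : ℕ := (val y j).getD 0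

/-- The clopen sets defining `H`. -/
def R (α : Omega1Index) (m : ℕ) (y : Yp D) : Prop :=
  ∀ j < m, (∃ v, val y j = some v ∧ v ≤ D.d α j) ∧ ¬ Gr (D.e α j) y

open Classical in
/-- The function with `R α m y ↔ m ≤ H α y`. -/
noncomputable def H (α : Omega1Index) (y : Yp D) : ℕ :=
  if h : ∃ m, ¬ R α (m + 1) y then Nat.find h else 0

open Classical in
/-- blow-up off `A ξ`. -/
noncomputable def K (p : Omega1Index × Omega1Index) : Yp D → ℕ
  | Yp.pt s k => if s.length ∉ D.A p.2 ∧ Gr p.1 (Yp.pt s k : Yp D) then s.length else 0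
  | _ => 0

theorem Gr_pt (β : Omega1Index) (s : List ℕ) :
    ∀ᶠ k in atTop, (Gr β (Yp.pt s k : Yp D) ↔ Gr β (Yp.lim s : Yp D)) := by
  filter_upwards [Ioi_mem_atTop (D.F β s)] with k hk
  have : k ≠ D.F β s := (ne_of_gt hk)
  simp [Gr, this]

theorem Gr_sq (β γ : Omega1Index) :
    ∀ᶠ n in (D.u : Filter ℕ), (Gr β (sq D γ n) ↔ Gr β (Yp.inf γ : Yp D)) := by
  by_cases h : γ = β
  · subst h
    simp [Gr, sq, br_length]
  · obtain ⟨m, hm⟩ := br_ne D h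
    refine ev_u m fun n hn => ?_
    simp [Gr, sq, br_length, hm n hn, h]

theorem val_sq (γ : Omega1Index) (j : ℕ) :
    ∀ᶠ n in (D.u : Filter ℕ), val (sq D γ n) j = val (Yp.inf γ : Yp D) j := by
  refine ev_u j fun n hn => ?_
  simp [val, sq, br_get D γ n j hn]

theorem cont_single (p : List ℕ × ℕ) : Continuous (single p : Yp D → ℕ) := by
  refine continuous_nat (fun s => ?_) (fun γ => ?_)
  · filter_upwards [Ioi_mem_atTop p.2] with k hk
    have : k ≠ p.2 := (ne_of_gt hk)
    simp [single, this]
  · refine ev_u p.1.length fun n hn => ?_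
    have : br D γ n ≠ p.1 := by
      intro h
      have := congrArg List.length h
      rw [br_length] at this
      omega
    simp [single, sq, this]

theorem cont_col (p : List ℕ) : Continuous (col p : Yp D → ℕ) := by
  refine continuous_nat (fun s => ?_) (fun γ => ?_)
  · simp [col]
  · refine ev_u p.length fun n hn => ?_
    have : br D γ n ≠ p := by
      intro h
      have := congrArg List.length h
      rw [br_length] at this
      omega
    simp [col, sq, this]

theorem cont_gr (β : Omega1Index) : Continuous (gr β : Yp D → ℕ) := by
  refine continuous_nat (fun s => ?_) (fun γ => ?_)
  · filter_upwards [Gr_pt β s] with k hk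
    unfold gr; by_cases hg : Gr β (Yp.lim s : Yp D)
    · rw [if_pos hg, if_pos (hk.2 hg)]
    · rw [if_neg hg, if_neg (fun h => hg (hk.1 h))]
  · filter_upwards [Gr_sq β γ] with k hk
    unfold gr; by_cases hg : Gr β (Yp.inf γ : Yp D)
    · rw [if_pos hg, if_pos (hk.2 hg)]
    · rw [if_neg hg, if_neg (fun h => hg (hk.1 h))]

theorem cont_J (j : ℕ) : Continuous (J j : Yp D → ℕ) := by
  refine continuous_nat (fun s => ?_) (fun γ => ?_)
  · simp [J, val]
  · filter_upwards [val_sq γ j] with k hk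
    simp [J, hk]

theorem cont_K (p : Omega1Index × Omega1Index) : Continuous (K p : Yp D → ℕ) := by
  refine continuous_nat (fun s => ?_) (fun γ => ?_)
  · filter_upwards [Gr_pt p.1 s] with k hk
    have : ¬ Gr p.1 (Yp.pt s k : Yp D) := by rw [hk]; simp [Gr]
    simp [K, this]
  · filter_upwards [Gr_sq p.1 γ, D.A_mem p.2] with k hk hA
    simp only [K, sq]
    rw [if_neg]
    rw [br_length]
    exact fun h => h.1 hA

theorem R_pt (α : Omega1Index) (m : ℕ) (s : List ℕ) :
    ∀ᶠ k in atTop, (R α m (Yp.pt s k : Yp D) ↔ R α m (Yp.lim s : Yp D)) := by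
  have : ∀ᶠ k in atTop, ∀ j ∈ Set.Iio m,
      (Gr (D.e α j) (Yp.pt s k : Yp D) ↔ Gr (D.e α j) (Yp.lim s : Yp D)) :=
    (eventually_all_finite (Set.finite_Iio m)).2 fun j _ => Gr_pt _ s
  filter_upwards [this] with k hk
  refine forall_congr' fun j => forall_congr' fun hj => ?_
  rw [hk j hj]
  simp [val]

theorem R_sq (α : Omega1Index) (m : ℕ) (γ : Omega1Index) :
    ∀ᶠ n in (D.u : Filter ℕ), (R α m (sq D γ n) ↔ R α m (Yp.inf γ : Yp D)) := by
  have : ∀ᶠ n in (D.u : Filter ℕ), ∀ j ∈ Set.Iio m,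
      (Gr (D.e α j) (sq D γ n) ↔ Gr (D.e α j) (Yp.inf γ : Yp D)) :=
    (eventually_all_finite (Set.finite_Iio m)).2 fun j _ => Gr_sq _ _
  have h2 : ∀ᶠ n in (D.u : Filter ℕ), ∀ j ∈ Set.Iio m,
      (val (sq D γ n) j = val (Yp.inf γ : Yp D) j) :=
    (eventually_all_finite (Set.finite_Iio m)).2 fun j _ => val_sq _ _
  filter_upwards [this, h2] with k hk hk2
  refine forall_congr' fun j => forall_congr' fun hj => ?_
  rw [hk j hj, hk2 j hj]

theorem R_mono {α : Omega1Index} {m n : ℕ} {y : Yp D} (h : m ≤ n) (hR : R α n y) : R α m y :=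
  fun j hj => hR j (hj.trans_le h)

theorem R_bdd (α : Omega1Index) (y : Yp D) : ∃ m, ¬ R α (m + 1) y := by
  have hl : ∀ s : List ℕ, ¬ ∃ v, s[s.length]? = some v ∧ v ≤ D.d α s.length := by
    intro s; simp
  rcases y with ⟨s, k⟩ | s | β
  · exact ⟨s.length, fun h => hl s (h s.length (Nat.lt_succ_self _)).1⟩
  · exact ⟨s.length, fun h => hl s (h s.length (Nat.lt_succ_self _)).1⟩
  · rcases le_or_gt β α with h | h
    · obtain ⟨i, hi⟩ := D.e_range α β h
      exact ⟨i, fun h => (h i (Nat.lt_succ_self _)).2 (by simp [Gr, hi])⟩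
    · obtain ⟨i, hi⟩ := D.x_not_le α β h
      refine ⟨i, fun h => ?_⟩
      obtain ⟨v, hv, hv2⟩ := (h i (Nat.lt_succ_self _)).1
      simp only [val, Option.some.injEq] at hv
      omega

theorem R_iff (α : Omega1Index) (m : ℕ) (y : Yp D) : R α m y ↔ m ≤ H α y := by
  classical
  have h := R_bdd α y
  simp only [H, dif_pos h]
  rw [Nat.le_find_iff]
  constructor
  · intro hR k hk
    exact not_not.2 (R_mono hk hR)
  · intro hk
    rcases m with _ | m
    · intro j hj; omega
    · exact not_not.1 (hk m (Nat.lt_succ_self _))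

theorem cont_H (α : Omega1Index) : Continuous (H α : Yp D → ℕ) := by
  have key : ∀ y z : Yp D, (R α (H α y) z ↔ R α (H α y) y) →
      (R α (H α y + 1) z ↔ R α (H α y + 1) y) → H α z = H α y := by
    intro y z h1 h2
    rw [R_iff, R_iff] at h1 h2
    omega
  refine continuous_nat (fun s => ?_) (fun γ => ?_)
  · filter_upwards [R_pt α (H α (Yp.lim s)) s, R_pt α (H α (Yp.lim s) + 1) s] with k h1 h2
    exact key _ _ h1 h2
  · filter_upwards [R_sq α (H α (Yp.inf γ)) γ, R_sq α (H α (Yp.inf γ) + 1) γ] with k h1 h2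
    exact key _ _ h1 h2

/-- Index type of the coordinate functions. -/
abbrev Idx : Type 1 := ((List ℕ × ℕ) ⊕ List ℕ ⊕ ℕ) ⊕ Omega1Index ⊕ Omega1Index ⊕
  (Omega1Index × Omega1Index)

/-- The coordinate functions. -/
noncomputable def Fam : Idx → Yp D → ℕ :=
  Sum.elim (Sum.elim single (Sum.elim col J)) (Sum.elim gr (Sum.elim H K))

theorem cont_Fam (i : Idx) : Continuous (Fam i : Yp D → ℕ) := by
  rcases i with (i | i | i) | i | i | i
  · exact cont_single i
  · exact cont_col i
  · exact cont_J i
  · exact cont_gr i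
  · exact cont_H i
  · exact cont_K i

theorem Fam_sep (y z : Yp D) (h : ∀ i, Fam i y = Fam i z) : y = z := by
  have h1 : ∀ p, single p y = single p z := fun p => h (Sum.inl (Sum.inl p))
  have h2 : ∀ p, col p y = col p z := fun p => h (Sum.inl (Sum.inr (Sum.inl p)))
  have h3 : ∀ p, gr p y = gr p z := fun p => h (Sum.inr (Sum.inl p))
  rcases y with ⟨s, k⟩ | s | β
  · have := h1 (s, k)
    simp only [single, if_true] at this
    by_contra hne
    rw [if_neg (Ne.symm hne)] at this
    omega
  · rcases z with ⟨s', k'⟩ | s' | β'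
    · have := h1 (s', k')
      simp [single] at this
    · have := h2 s
      simp only [col, if_true] at this
      by_contra hne
      rw [if_neg] at this
      · omega
      · rintro rfl; exact hne rfl
    · have := h2 s
      simp [col] at this
  · rcases z with ⟨s', k'⟩ | s' | β'
    · have := h1 (s', k')
      simp [single] at this
    · have := h2 s'
      simp [col] at this
    · have := h3 β
      unfold gr at this
      rw [if_pos (show Gr β (Yp.inf β : Yp D) from rfl)] at this
      by_contra hne
      rw [if_neg] at this
      · omega
      · intro h; exact hne (congrArg Yp.inf (show β' = β from h).symm)

theorem pure_le_nhds' {q : Ultrafilter (Yp D)} {S : Set (Yp D)} (hS : S.Finite) (h : S ∈ q) :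
    ∃ y, (q : Filter (Yp D)) ≤ 𝓝 y := by
  obtain ⟨y, -, hy⟩ := Ultrafilter.eq_pure_of_finite_mem hS h
  exact ⟨y, by rw [hy]; exact pure_le_nhds y⟩

theorem complete (q : Ultrafilter (Yp D))
    (hq : ∀ i, ∃ M, ∀ᶠ y in (q : Filter (Yp D)), Fam i y ≤ M) :
    ∃ y, (q : Filter (Yp D)) ≤ 𝓝 y := by
  have hJ : ∀ j, ∃ M, ∀ᶠ y in (q : Filter (Yp D)), J j y ≤ M :=
    fun j => hq (Sum.inl (Sum.inr (Sum.inr j)))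
  have hH : ∀ j, ∃ M, ∀ᶠ y in (q : Filter (Yp D)), H j y ≤ M :=
    fun j => hq (Sum.inr (Sum.inr (Sum.inl j)))
  have hK : ∀ j, ∃ M, ∀ᶠ y in (q : Filter (Yp D)), K j y ≤ M :=
    fun j => hq (Sum.inr (Sum.inr (Sum.inr j)))
  have hv : ∀ j, ∃ v, ∀ᶠ y in (q : Filter (Yp D)), val y j = v := by
    intro j
    obtain ⟨M, hM⟩ := hJ j
    have hfin : (insert none (some '' Set.Iic M)).Finite :=
      ((Set.finite_Iic M).image some).insert none
    have hmem : (insert none (some '' Set.Iic M)) ∈ q.map (fun y => val y j) := by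
      rw [Ultrafilter.mem_map]
      filter_upwards [hM] with y hy
      simp only [J] at hy
      cases hvy : val y j with
      | none => simp [hvy]
      | some v => simp [hvy] at hy ⊢; exact hy
    obtain ⟨v, -, hv⟩ := Ultrafilter.eq_pure_of_finite_mem hfin hmem
    refine ⟨v, ?_⟩
    have : {v} ∈ q.map (fun y => val y j) := by rw [hv]; simp
    exact this
  choose v hv using hv
  by_cases hnone : ∃ j, v j = none
  · obtain ⟨j, hj⟩ := hnone
    have hall : ∀ᶠ y in (q : Filter (Yp D)), ∀ i ∈ Set.Iic j, val y i = v i :=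
      (eventually_all_finite (Set.finite_Iic j)).2 fun i _ => hv i
    have hlist : ∀ s s' : List ℕ, (∀ i ≤ j, s[i]? = v i) → (∀ i ≤ j, s'[i]? = v i) → s = s' := by
      intro s s' h h'
      have l1 : s.length ≤ j := by
        have := h j le_rfl; rw [hj] at this; simpa using this
      have l2 : s'.length ≤ j := by
        have := h' j le_rfl; rw [hj] at this; simpa using this
      refine List.ext_getElem? fun i => ?_
      rcases le_or_gt i j with hi | hi
      · rw [h i hi, h' i hi]
      · rw [List.getElem?_eq_none (by omega), List.getElem?_eq_none (by omega)]
    have hex : ∃ s : List ℕ, ∀ i ≤ j, s[i]? = v i := by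
      obtain ⟨y, hy⟩ := hall.exists
      rcases y with ⟨s, k⟩ | s | β
      · exact ⟨s, hy⟩
      · exact ⟨s, hy⟩
      · have := hy j (Set.mem_Iic.2 le_rfl)
        rw [hj] at this
        simp [val] at this
    obtain ⟨s, hs⟩ := hex
    have hcol : ∀ᶠ y in (q : Filter (Yp D)), y = Yp.lim s ∨ ∃ k, y = Yp.pt s k := by
      filter_upwards [hall] with y hy
      rcases y with ⟨s', k⟩ | s' | β
      · rw [hlist s' s hy hs]; exact Or.inr ⟨k, rfl⟩
      · rw [hlist s' s hy hs]; exact Or.inl rfl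
      · have := hy j (Set.mem_Iic.2 le_rfl)
        rw [hj] at this
        simp [val] at this
    by_contra hcon0
    have hcon : ¬ (q : Filter (Yp D)) ≤ 𝓝 (Yp.lim s) := fun h => hcon0 ⟨_, h⟩
    rw [Filter.not_le] at hcon
    obtain ⟨U, hU, hUq⟩ := hcon
    have hUq' : Uᶜ ∈ q := Ultrafilter.compl_mem_iff_notMem.2 hUq
    have := (tendsto_pt (D := D) s).eventually hU
    obtain ⟨m, hm⟩ := eventually_atTop.1 this
    refine hcon0 (pure_le_nhds' (S := (fun k => Yp.pt s k) '' Set.Iio m)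
      ((Set.finite_Iio m).image _) ?_)
    filter_upwards [hUq', hcol] with y hy hy2
    rcases hy2 with rfl | ⟨k, rfl⟩
    · exact absurd (mem_of_mem_nhds hU) hy
    · refine ⟨k, ?_, rfl⟩
      by_contra hk
      exact hy (hm k (not_lt.1 hk))
  · have hsome : ∀ j, ∃ a, v j = some a := fun j =>
      Option.ne_none_iff_exists'.1 fun h => hnone ⟨j, h⟩
    choose a ha using hsome
    obtain ⟨α, hα⟩ := D.d_dom a
    by_cases hG : ∃ β, ∀ᶠ y in (q : Filter (Yp D)), Gr β y
    · obtain ⟨β, hβ⟩ := hG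
      by_cases hp : {Yp.inf β} ∈ q
      · exact pure_le_nhds' (Set.finite_singleton _) hp
      have hp' : {Yp.inf β}ᶜ ∈ q := Ultrafilter.compl_mem_iff_notMem.2 hp
      have hr : Set.range (sq D β) ∈ q := by
        filter_upwards [hp', hβ] with y hy hy2
        rcases y with ⟨s, k⟩ | s | γ
        · refine ⟨s.length, ?_⟩
          rw [sq, ← hy2.1, ← hy2.2]
        · exact hy2.elim
        · exact absurd (congrArg Yp.inf (show γ = β from hy2)) hy
      have hinj : Function.Injective (sq D β) := by
        intro m n h
        simp only [sq, Yp.pt.injEq] at h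
        have := congrArg List.length h.1
        simpa [br_length] using this
      let q' : Ultrafilter ℕ := q.comap hinj hr
      have hmap : (q : Filter (Yp D)) = Filter.map (sq D β) (q' : Filter ℕ) := by
        simp only [q', Ultrafilter.coe_comap]
        rw [Filter.map_comap_of_mem hr]
      by_cases hA : ∀ ξ, D.A ξ ∈ q'
      · refine ⟨Yp.inf β, ?_⟩
        rw [hmap, D.A_gen q' hA]
        exact tendsto_sq β
      · push Not at hA
        obtain ⟨ξ, hξ⟩ := hA
        have hξ' : (D.A ξ)ᶜ ∈ q' := Ultrafilter.compl_mem_iff_notMem.2 hξ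
        obtain ⟨M, hM⟩ := hK (β, ξ)
        rw [hmap, Filter.eventually_map] at hM
        refine pure_le_nhds' (S := sq D β '' Set.Iic M) ((Set.finite_Iic M).image _) ?_
        rw [← Ultrafilter.mem_coe, hmap]
        refine Filter.image_mem_map ?_
        filter_upwards [hξ', hM] with n hn hnM
        simp only [K, sq] at hnM
        rw [if_pos, br_length] at hnM
        · exact hnM
        · rw [br_length]
          exact ⟨hn, by simp [Gr, br_length]⟩
    · exfalso
      push Not at hG
      obtain ⟨M, hM⟩ := hH α
      have hR : ∀ᶠ y in (q : Filter (Yp D)), R α (M + 1) y := by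
        have h1 : ∀ᶠ y in (q : Filter (Yp D)), ∀ j ∈ Set.Iio (M + 1), val y j = v j :=
          (eventually_all_finite (Set.finite_Iio _)).2 fun i _ => hv i
        have h2 : ∀ᶠ y in (q : Filter (Yp D)), ∀ j ∈ Set.Iio (M + 1), ¬ Gr (D.e α j) y :=
          (eventually_all_finite (Set.finite_Iio _)).2 fun i _ =>
            hG _
        filter_upwards [h1, h2] with y h1 h2 j hj
        exact ⟨⟨a j, by rw [h1 j hj, ha], hα j⟩, h2 j hj⟩
      obtain ⟨y, hy1, hy2⟩ := (hM.and hR).exists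
      rw [R_iff] at hy2
      omega

variable (D) in
/-- The embedding. -/
noncomputable def Phi (ρ : Omega1Index → Idx) (y : Yp D) : Omega1Index → ℝ :=
  fun w => (Fam (ρ w) y : ℝ)

theorem Phi_closed {ρ : Omega1Index → Idx} (hρ : Function.Surjective ρ) :
    IsClosedEmbedding (Phi D ρ) := by
  have hinj : Function.Injective (Phi D ρ) := by
    intro y z h
    refine Fam_sep y z fun i => ?_
    obtain ⟨w, rfl⟩ := hρ i
    have := congrFun h w
    simpa [Phi] using this
  have hcont : Continuous (Phi D ρ) :=
    continuous_pi fun w => continuous_of_discreteTopology.comp (cont_Fam (ρ w))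
  refine IsClosedEmbedding.of_continuous_injective_isClosedMap hcont hinj ?_
  refine IsProperMap.isClosedMap (isProperMap_iff_ultrafilter.2 ⟨hcont, fun q z hz => ?_⟩)
  have : ∃ y, (q : Filter (Yp D)) ≤ 𝓝 y := by
    refine complete q fun i => ?_
    obtain ⟨w, rfl⟩ := hρ i
    have hw := (tendsto_pi_nhds.1 hz) w
    have hlt := hw.eventually (gt_mem_nhds (lt_add_one (z w)))
    refine ⟨⌈z w + 1⌉₊, ?_⟩
    filter_upwards [hlt] with y hy
    have : (Fam (ρ w) y : ℝ) ≤ (⌈z w + 1⌉₊ : ℝ) := hy.le.trans (Nat.le_ceil _)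
    exact_mod_cast this
  obtain ⟨y, hy⟩ := this
  refine ⟨y, ?_, hy⟩
  exact tendsto_nhds_unique ((hcont.tendsto y).mono_left hy) hz

theorem closed_sub (T : Set (Yp D)) (hT : T ⊆ Set.range Yp.lim) : IsClosed T := by
  rw [← isOpen_compl_iff, isOpen_iff']
  constructor
  · intro s _
    refine Eventually.of_forall fun k h => ?_
    obtain ⟨s', hs⟩ := hT h
    cases hs
  · intro s _
    refine Eventually.of_forall fun k h => ?_
    obtain ⟨s', hs⟩ := hT h
    cases hs

theorem ext_bdd (φ : List ℕ → ℝ) (M : ℝ) (hM : ∀ s, |φ s| ≤ M) :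
    ∃ g : Yp D → ℝ, Continuous g ∧ ∀ s, g (Yp.lim s) = φ s := by
  have : ∀ β, ∃ r, Tendsto (fun n => φ (br D β n)) D.u (𝓝 r) := by
    intro β
    have hc : IsCompact (Set.Icc (-M) M) := isCompact_Icc
    obtain ⟨r, -, hr⟩ := hc.ultrafilter_le_nhds (D.u.map fun n => φ (br D β n)) (by
      rw [le_principal_iff, Ultrafilter.mem_coe, Ultrafilter.mem_map]
      exact Filter.univ_mem' fun n => abs_le.1 (hM _))
    exact ⟨r, hr⟩
  choose r hr using this
  let g : Yp D → ℝ := fun y => match y with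
    | Yp.pt s _ => φ s
    | Yp.lim s => φ s
    | Yp.inf β => r β
  refine ⟨g, continuous_of (fun s => tendsto_const_nhds) (fun β => hr β), fun s => rfl⟩

theorem no_ext (g : Yp D → ℝ) (hg : Continuous g) (h : ∀ s : List ℕ, g (Yp.lim s) = s.length) :
    False := by
  have : ∀ s : List ℕ, ∃ m, ∀ k, m ≤ k → (s.length : ℝ) - 1 < g (Yp.pt s k) := by
    intro s
    have := ((hg.tendsto _).comp (tendsto_pt s)).eventually
      (lt_mem_nhds (show (s.length : ℝ) - 1 < g (Yp.lim s) by rw [h]; linarith))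
    exact eventually_atTop.1 this
  choose m hm using this
  obtain ⟨β, hβ⟩ := D.F_dom m
  have h1 := ((hg.tendsto _).comp (tendsto_sq β)).eventually
    (gt_mem_nhds (lt_add_one (g (Yp.inf β))))
  have h2 : ∀ᶠ n : ℕ in (D.u : Filter ℕ), g (Yp.inf β) + 2 < (n : ℝ) := by
    obtain ⟨N, hN⟩ := exists_nat_gt (g (Yp.inf β) + 2)
    exact ev_u N fun n hn => hN.trans (by exact_mod_cast hn)
  obtain ⟨n, hn1, hn2⟩ := (h1.and h2).exists
  have := hm (br D β n) _ (hβ _)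
  rw [br_length] at this
  simp only [Function.comp, sq] at hn1
  linarith

theorem mk_W : Cardinal.mk Omega1Index = Cardinal.aleph 1 := by
  have := Cardinal.mk_Iio_ordinal (Ordinal.omega.{0} 1)
  refine Eq.trans this ?_
  simp

theorem aleph0_le_W : Cardinal.aleph0 ≤ Cardinal.mk Omega1Index := by
  rw [mk_W]; exact Cardinal.aleph0_le_aleph 1

theorem mk_Y : Cardinal.mk (Yp D) = Cardinal.aleph 1 := by
  apply le_antisymm
  · let f : (List ℕ × ℕ) ⊕ List ℕ ⊕ Omega1Index → Yp D :=
      Sum.elim (fun p => Yp.pt p.1 p.2) (Sum.elim Yp.lim Yp.inf)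
    have hf : Function.Surjective f := by
      rintro (⟨s, k⟩ | s | β)
      · exact ⟨Sum.inl (s, k), rfl⟩
      · exact ⟨Sum.inr (Sum.inl s), rfl⟩
      · exact ⟨Sum.inr (Sum.inr β), rfl⟩
    refine (Cardinal.mk_le_of_surjective hf).trans ?_
    have h := Cardinal.aleph0_le_aleph.{1} 1
    simp [mk_W, Cardinal.add_eq_right h h]
  · rw [← mk_W]
    exact Cardinal.mk_le_of_injective (f := (Yp.inf : Omega1Index → Yp D)) fun a b h => by
      simpa using h

theorem exists_rho : ∃ ρ : Omega1Index → Idx, Function.Surjective ρ := by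
  have : Cardinal.mk Idx ≤ Cardinal.mk Omega1Index := by
    have h := Cardinal.aleph0_le_aleph.{1} 1
    simp [mk_W, Cardinal.add_eq_right h h]
  obtain ⟨f⟩ := this
  exact ⟨Function.invFun f, Function.invFun_surjective f.injective⟩

theorem main (D : Dat) :
    ∃ B : Set (Omega1Index → ℝ), IsClosed B ∧ Cardinal.mk B = Cardinal.aleph 1 ∧
      ∃ N : Set (Omega1Index → ℝ), ∃ hNB : N ⊆ B,
        N.Countable ∧ N.Infinite ∧
        IsClosed ((fun b : B => (b : Omega1Index → ℝ)) ⁻¹' N) ∧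
        DiscreteTopology N ∧
        (∀ f : C(N, ℝ), (∃ M : ℝ, ∀ x : N, |f x| ≤ M) →
          ∃ g : C(B, ℝ), ∀ x : N, g ⟨x.val, hNB x.prop⟩ = f x) ∧
        ¬ (∀ f : C(N, ℝ), ∃ g : C(B, ℝ), ∀ x : N, g ⟨x.val, hNB x.prop⟩ = f x) := by
  obtain ⟨ρ, hρ⟩ := exists_rho
  have hΦ := Phi_closed (D := D) hρ
  let e : Yp D ≃ₜ Set.range (Phi D ρ) := hΦ.isEmbedding.toHomeomorph
  let ι : List ℕ → Omega1Index → ℝ := fun s => Phi D ρ (Yp.lim s)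
  have hι : Function.Injective ι := hΦ.injective.comp fun a b h => by simpa using h
  have hNB : Set.range ι ⊆ Set.range (Phi D ρ) := by
    rintro _ ⟨s, rfl⟩; exact ⟨_, rfl⟩
  have hcl : ∀ T ⊆ Set.range ι, IsClosed T := by
    intro T hT
    have : T = Phi D ρ '' (Phi D ρ ⁻¹' T) := by
      rw [Set.image_preimage_eq_of_subset (hT.trans hNB)]
    rw [this]
    refine hΦ.isClosedMap _ (closed_sub _ ?_)
    intro y hy
    obtain ⟨s, hs⟩ := hT hy
    exact ⟨s, hΦ.injective hs⟩
  have hdisc : DiscreteTopology (Set.range ι) := by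
    rw [discreteTopology_iff_forall_isClosed]
    intro T
    have := (hcl (Subtype.val '' T) (by rintro _ ⟨x, -, rfl⟩; exact x.2)).preimage
      (continuous_subtype_val : Continuous (Subtype.val : Set.range ι → _))
    rwa [Set.preimage_image_eq _ Subtype.val_injective] at this
  refine ⟨Set.range (Phi D ρ), hΦ.isClosed_range, ?_, Set.range ι, hNB, Set.countable_range ι,
    Set.infinite_range_of_injective hι, ?_, hdisc, ?_, ?_⟩
  · rw [Cardinal.mk_range_eq _ hΦ.injective, mk_Y]
  · exact (hcl _ subset_rfl).preimage continuous_subtype_val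
  · rintro f ⟨M, hM⟩
    obtain ⟨g, hg, hgs⟩ := ext_bdd (D := D) (fun s => f ⟨ι s, s, rfl⟩) M (fun s => hM _)
    refine ⟨⟨g ∘ e.symm, hg.comp e.symm.continuous⟩, ?_⟩
    rintro ⟨_, s, rfl⟩
    have : e.symm ⟨ι s, hNB ⟨s, rfl⟩⟩ = Yp.lim s := by
      rw [Homeomorph.symm_apply_eq]; rfl
    simp only [ContinuousMap.coe_mk, Function.comp]
    rw [this, hgs]
  · intro hall
    obtain ⟨j, hj⟩ := hι.hasLeftInverse
    obtain ⟨g, hg⟩ := hall ⟨fun x => ((j x.1).length : ℝ), continuous_of_discreteTopology⟩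
    refine no_ext (D := D) (g ∘ e) (g.continuous.comp e.continuous) fun s => ?_
    have := hg ⟨ι s, s, rfl⟩
    simp only [ContinuousMap.coe_mk, hj s] at this
    exact this

theorem exists_dat
    (hd : ∃ D : Set (ℕ → ℕ), Cardinal.mk D ≤ Cardinal.aleph 1 ∧
      ∀ g : ℕ → ℕ, ∃ f ∈ D, ∀ n, g n ≤ f n)
    (hu : ∃ (u : Ultrafilter ℕ) (B : Set (Set ℕ)), (∀ a : ℕ, u ≠ pure a) ∧
      Cardinal.mk B ≤ Cardinal.aleph 1 ∧ (u : Filter ℕ) = Filter.generate B) :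
    Nonempty Dat := by
  obtain ⟨D, hDc, hD⟩ := hd
  obtain ⟨u, B, hfree, hBc, hB⟩ := hu
  have surj : ∀ {T : Type} (S : Set T), Cardinal.mk S ≤ Cardinal.aleph 1 → S.Nonempty →
      ∃ f : Omega1Index → T, Set.range f = S := by
    intro T S hS hne
    have : Cardinal.lift.{1} (Cardinal.mk S) ≤ Cardinal.lift.{0} (Cardinal.mk Omega1Index) := by
      rw [mk_W]
      simpa using Cardinal.lift_le.{1}.2 hS
    obtain ⟨f⟩ := Cardinal.lift_mk_le'.1 this
    have : Nonempty S := hne.to_subtype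
    refine ⟨fun w => ((Function.invFun f w : S) : T), ?_⟩
    have h := Function.invFun_surjective f.injective
    ext t
    constructor
    · rintro ⟨w, rfl⟩; exact Subtype.property _
    · intro ht
      obtain ⟨w, hw⟩ := h ⟨t, ht⟩
      exact ⟨w, by simp [hw]⟩
  have hDne : D.Nonempty := by
    obtain ⟨f, hf, -⟩ := hD 0; exact ⟨f, hf⟩
  obtain ⟨d, hdr⟩ := surj D hDc hDne
  have hdd : ∀ g : ℕ → ℕ, ∃ α, ∀ n, g n ≤ d α n := by
    intro g
    obtain ⟨f, hf, h⟩ := hD g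
    rw [← hdr] at hf
    obtain ⟨α, rfl⟩ := hf
    exact ⟨α, h⟩
  have hu1 : (u : Filter ℕ) ≤ cofinite := by
    rcases u.le_cofinite_or_eq_pure with h | ⟨a, h⟩
    · exact h
    · exact absurd h (hfree a)
  have hu2 : (u : Filter ℕ) ≤ atTop := by rwa [← Nat.cofinite_eq_atTop]
  have hBne : B.Nonempty := by
    by_contra hne
    rw [Set.not_nonempty_iff_eq_empty] at hne
    rw [hne, Filter.generate_empty] at hB
    have : Set.Ioi 0 ∈ (u : Filter ℕ) := hu2 (Ioi_mem_atTop 0)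
    rw [hB, mem_top] at this
    have h0 : (0 : ℕ) ∈ Set.Ioi 0 := by rw [this]; trivial
    exact lt_irrefl _ (Set.mem_Ioi.1 h0)
  obtain ⟨A, hA⟩ := surj B hBc hBne
  have hcount : ∀ α : Omega1Index, ∃ e : ℕ → Omega1Index, ∀ β ≤ α, ∃ i, e i = β := by
    intro α
    have hc : (Set.Iic α).Countable := by
      rw [← Cardinal.le_aleph0_iff_set_countable, ← Cardinal.lt_aleph_one_iff]
      have h1 : Order.succ α.1 < Ordinal.omega 1 :=
        (Cardinal.isSuccLimit_omega 1).succ_lt α.2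
      have h2 : (Order.succ α.1).card < Cardinal.aleph 1 := by
        rw [← Cardinal.lt_ord]; simpa using h1
      have h3 : Cardinal.mk (Set.Iic α) ≤ Cardinal.mk (Set.Iio (Order.succ α.1)) := by
        refine Cardinal.mk_le_of_injective
          (f := fun β => ⟨β.1.1, Set.mem_Iio.2 (Order.lt_succ_iff.2 β.2)⟩) fun a b h => ?_
        apply Subtype.ext; apply Subtype.ext
        simpa using h
      rw [Cardinal.mk_Iio_ordinal] at h3
      refine h3.trans_lt ?_
      exact Cardinal.lift_lt_aleph_one.2 h2
    obtain ⟨e, he⟩ := hc.exists_eq_range ⟨α, Set.mem_Iic.2 le_rfl⟩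
    exact ⟨e, fun β hβ => by
      have : β ∈ Set.range e := by rw [← he]; exact hβ
      exact this⟩
  choose e he using hcount
  obtain ⟨b⟩ : Nonempty (Omega1Index ↪ (ℕ → Bool)) := by
    apply Cardinal.lift_mk_le'.1
    rw [mk_W]
    simpa using Cardinal.aleph_one_le_continuum
  refine ⟨{
    x := fun β i => 2 * (d (e β i) i + 1) + (b β i).toNat
    F := fun β s => d β (Encodable.encode s)
    u := u
    d := d
    e := e
    A := A
    x_inj := ?_
    x_not_le := ?_
    e_range := he
    d_dom := hdd
    F_dom := ?_
    u_free := hu2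
    A_mem := ?_
    A_gen := ?_ }⟩
  · intro β γ h
    apply b.injective
    funext i
    have := congrFun h i
    have h1 := congrArg (· % 2) this
    cases h1' : b β i <;> cases h2' : b γ i <;> simp [h1', h2'] at h1 ⊢
  · intro α β h
    obtain ⟨i, hi⟩ := he β α h.le
    refine ⟨i, ?_⟩
    simp only [hi]
    omega
  · intro g
    obtain ⟨α, h⟩ := hdd fun n => g (Denumerable.ofNat (List ℕ) n)
    exact ⟨α, fun s => by simpa using h (Encodable.encode s)⟩
  · intro ξ
    have : A ξ ∈ B := by rw [← hA]; exact ⟨ξ, rfl⟩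
    rw [← Ultrafilter.mem_coe, hB]
    exact Filter.mem_generate_of_mem this
  · intro v hv
    have : (v : Filter ℕ) ≤ u := by
      rw [hB, Filter.le_generate_iff]
      intro S hS
      rw [← hA] at hS
      obtain ⟨ξ, rfl⟩ := hS
      exact hv ξ
    exact Ultrafilter.coe_le_coe.1 this

end CStarEx

/-- Assume `𝔡 = 𝔲 = ℵ₁`: (i) there is a dominating family of functions `ℕ → ℕ` of size at
most `ℵ₁`, and (ii) there is a free ultrafilter on `ℕ` generated by a base of size at most
`ℵ₁`.  Then there is a closed subset `B` of `ℝ^{ω₁}` of cardinality `ℵ₁` containing a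
countably infinite subset `N` that is closed in `B`, discrete, `C*`-embedded in `B` but
not `C`-embedded in `B`. -/
theorem exists_Cstar_not_C_embedded_copy_of_N
    (hd : ∃ D : Set (ℕ → ℕ), Cardinal.mk D ≤ Cardinal.aleph 1 ∧
      ∀ g : ℕ → ℕ, ∃ f ∈ D, ∀ n, g n ≤ f n)
    (hu : ∃ (u : Ultrafilter ℕ) (B : Set (Set ℕ)), (∀ a : ℕ, u ≠ pure a) ∧
      Cardinal.mk B ≤ Cardinal.aleph 1 ∧ (u : Filter ℕ) = Filter.generate B) :
    ∃ B : Set (Omega1Index → ℝ), IsClosed B ∧ Cardinal.mk B = Cardinal.aleph 1 ∧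
      ∃ N : Set (Omega1Index → ℝ), ∃ hNB : N ⊆ B,
        N.Countable ∧ N.Infinite ∧
        IsClosed ((fun b : B => (b : Omega1Index → ℝ)) ⁻¹' N) ∧
        DiscreteTopology N ∧
        (∀ f : C(N, ℝ), (∃ M : ℝ, ∀ x : N, |f x| ≤ M) →
          ∃ g : C(B, ℝ), ∀ x : N, g ⟨x.val, hNB x.prop⟩ = f x) ∧
        ¬ (∀ f : C(N, ℝ), ∃ g : C(B, ℝ), ∀ x : N, g ⟨x.val, hNB x.prop⟩ = f x) := by
  obtain ⟨D⟩ := CStarEx.exists_dat hd hu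
  exact CStarEx.main D
end
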